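/- Let s and t be coprime positive integers and n, m integers with 0 < n < s and 0 < m < t. For every nonnegative integer K there is a constant C such that for all positive integers N, | Φ̃(1/N) + (N/i)^{3/2} · Σ_{(n′,m′)} S_{n,m}^{n′,m′} · (s − n′)·m′ · exp( −πi(n′t − m′s)²N/(2st) ) + (1/2) Σ_{k=0}^{K} ( L(−2k−1, χ)/k! ) · ( πi/(2stN) )^k | ≤ C·N^{−K−1}, where Φ̃(1/N) := (stN/2) Σ_{k=1}^{2stN} χ(k)·exp( πik²/(2stN) )·B₂( k/(2stN) ), the sum runs over pairs of integers (n′, m′) with 1 ≤ n′ ≤ s−1, 1 ≤ m′ ≤ t−1 and n′t − m′s > 0, S_{n,m}^{n′,m′} = √(8/(st)) · (−1)^{nm′ + n′m + 1} · sin( nn′tπ/s ) · sin( mm′sπ/t ), and L(−j, χ) := −( (2st)^j/(j+1) ) · Σ_{l=1}^{2st} χ(l) · B_{j+1}( l/(2st) ). (This is the quantum modularity / asymptotic expansion of the Eichler integral Φ̃ at τ = 1/N.) -/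

import Mathlib

open Complex Finset

/-- The 2st-periodic function `χ = χ_{2st}^{(n,m)}`. -/
def chi (s t n m k : ℤ) : ℤ :=
  if k ≡ n * t - m * s [ZMOD 2 * s * t] ∨ k ≡ -(n * t - m * s) [ZMOD 2 * s * t] then 1
  else if k ≡ n * t + m * s [ZMOD 2 * s * t] ∨ k ≡ -(n * t + m * s) [ZMOD 2 * s * t] then -1
  else 0

/-- The limiting value `Φ̃_{s,t}^{(n,m)}(1/N)` of the Eichler integral. -/
noncomputable def PhiTilde (s t n m : ℤ) (N : ℕ) : ℂ :=
  ((s * t * N : ℤ) : ℂ) / 2 *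
    ∑ k ∈ Finset.Icc (1 : ℤ) (2 * s * t * N),
      (chi s t n m k : ℂ) * Complex.exp (Real.pi * Complex.I * (k : ℂ) ^ 2 / (2 * s * t * N)) *
        (((k : ℂ) / (2 * s * t * N)) ^ 2 - (k : ℂ) / (2 * s * t * N) + 1 / 6)

/-- The `S`-matrix coefficient `S(s,t)_{n,m}^{n',m'}`. -/
noncomputable def Scoef (s t n m n' m' : ℤ) : ℝ :=
  Real.sqrt (8 / ((s : ℝ) * t)) * (-1 : ℝ) ^ (n * m' + n' * m + 1) *
    Real.sin ((n : ℝ) * n' * t * Real.pi / s) * Real.sin ((m : ℝ) * m' * s * Real.pi / t)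

/-- The L-value `L(-j, χ) = -((2st)^j/(j+1)) Σ_{l=1}^{2st} χ(l) B_{j+1}(l/(2st))`. -/
noncomputable def Lval (s t n m : ℤ) (j : ℕ) : ℂ :=
  -(((2 * s * t : ℤ) : ℂ) ^ j / ((j : ℂ) + 1)) *
    ∑ l ∈ Finset.Icc (1 : ℤ) (2 * s * t),
      (chi s t n m l : ℂ) *
        (((Polynomial.bernoulli (j + 1)).eval ((l : ℚ) / (2 * s * t)) : ℚ) : ℂ)


lemma aux_odd_int (c T : ℝ) (hc : c ≠ 0) :
    ∫ y in (-T)..T, (1 : ℂ) / ((y : ℂ) - c * I) = 2 * I * Real.arctan (T / c) := by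
  have key : ∀ y : ℝ, (y : ℂ) - c * I ≠ 0 := by
    intro y h
    have := congrArg Complex.im h
    simp at this
    exact hc this
  have hcont : Continuous fun y : ℝ => (1 : ℂ) / ((y : ℂ) - c * I) := by
    refine continuous_const.div (by fun_prop) key
  have h1 : ∫ y in (-T)..T, (1 : ℂ) / ((y : ℂ) - c * I) =
      ∫ y in (-T)..T, (1 : ℂ) / (((-y : ℝ) : ℂ) - c * I) := by
    have := intervalIntegral.integral_comp_neg (a := -T) (b := T)
      (fun y : ℝ => (1 : ℂ) / ((y : ℂ) - c * I))
    rw [this]; simp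
  have h2 : (2 : ℂ) * ∫ y in (-T)..T, (1 : ℂ) / ((y : ℂ) - c * I) =
      ∫ y in (-T)..T, ((1 : ℂ) / ((y : ℂ) - c * I) + (1 : ℂ) / (((-y : ℝ) : ℂ) - c * I)) := by
    rw [intervalIntegral.integral_add (hcont.intervalIntegrable _ _)
      (show IntervalIntegrable (fun y : ℝ => (1 : ℂ) / (((-y : ℝ) : ℂ) - c * I))
        MeasureTheory.volume _ _ from (hcont.comp continuous_neg).intervalIntegrable _ _),
      ← h1, two_mul]
  have h3 : ∀ y : ℝ, ((1 : ℂ) / ((y : ℂ) - c * I) + (1 : ℂ) / (((-y : ℝ) : ℂ) - c * I)) =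
      (2 * I) * (((c⁻¹ * (1 / (1 + (c⁻¹ * y) ^ 2)) : ℝ)) : ℂ) := by
    intro y
    have k1 := key y
    have k2 := key (-y)
    have k3 : (1 + (c⁻¹ * y) ^ 2 : ℝ) ≠ 0 := by positivity
    have k4 : (c ^ 2 + y ^ 2 : ℝ) ≠ 0 := by positivity
    have e : (c⁻¹ * (1 / (1 + (c⁻¹ * y) ^ 2)) : ℝ) = c / (c ^ 2 + y ^ 2) := by
      field_simp
    rw [e]
    rw [div_add_div _ _ k1 k2]
    have k5 : ((y : ℂ) - c * I) * (((-y : ℝ) : ℂ) - c * I) = - ((c ^ 2 + y ^ 2 : ℝ) : ℂ) := by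
      push_cast
      linear_combination (c : ℂ) ^ 2 * I_sq
    rw [k5]
    push_cast
    have k6 : ((c : ℂ) ^ 2 + (y : ℂ) ^ 2) ≠ 0 := by exact_mod_cast k4
    field_simp
    ring
  have h4 : (2 : ℂ) * ∫ y in (-T)..T, (1 : ℂ) / ((y : ℂ) - c * I) =
      2 * I * ((2 * Real.arctan (T / c) : ℝ) : ℂ) := by
    rw [h2, intervalIntegral.integral_congr (fun y _ => h3 y),
      intervalIntegral.integral_const_mul, intervalIntegral.integral_ofReal]
    congr 2
    rw [intervalIntegral.integral_const_mul]
    rw [intervalIntegral.integral_comp_mul_left (fun x : ℝ => 1 / (1 + x ^ 2)) (inv_ne_zero hc)]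
    rw [integral_one_div_one_add_sq]
    simp only [smul_eq_mul, inv_inv]
    rw [← mul_assoc, inv_mul_cancel₀ hc, one_mul, mul_neg, Real.arctan_neg]
    rw [div_eq_inv_mul]; ring
  rw [ofReal_mul] at h4
  simp only [ofReal_ofNat] at h4
  linear_combination h4 / 2

open Filter Topology in
lemma aux_lim_pos (c : ℝ) (hc : 0 < c) :
    Tendsto (fun T : ℝ => ∫ y in (-T)..T, (1 : ℂ) / ((y : ℂ) - c * I)) atTop
      (𝓝 (Real.pi * I)) := by
  simp_rw [aux_odd_int c _ hc.ne']
  have : Tendsto (fun T : ℝ => Real.arctan (T / c)) atTop (𝓝 (Real.pi / 2)) :=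
    (Real.tendsto_arctan_atTop.mono_right nhdsWithin_le_nhds).comp
      (tendsto_id.atTop_div_const hc)
  have h2 := ((continuous_ofReal.tendsto _).comp this).const_mul (2 * I)
  have e : 2 * I * ((Real.pi / 2 : ℝ) : ℂ) = Real.pi * I := by push_cast; ring
  rw [e] at h2
  exact h2

open Filter Topology in
lemma aux_lim_neg (c : ℝ) (hc : 0 < c) :
    Tendsto (fun T : ℝ => ∫ y in (-T)..T, (1 : ℂ) / ((y : ℂ) + c * I)) atTop
      (𝓝 (-(Real.pi * I))) := by
  have h := (aux_lim_pos c hc).neg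
  refine h.congr fun T => ?_
  have e1 := aux_odd_int c T hc.ne'
  have e2 := aux_odd_int (-c) T (by simpa using hc.ne')
  rw [e1]
  have : ∀ y : ℝ, (1 : ℂ) / ((y : ℂ) + c * I) = (1 : ℂ) / ((y : ℂ) - ((-c : ℝ) : ℂ) * I) := by
    intro y; push_cast; ring_nf
  simp_rw [this, e2, div_neg, Real.arctan_neg]
  rw [ofReal_neg]; ring

open Filter Topology in
lemma strip_residue (φ f : ℂ → ℂ) (p : ℂ) (h : ℝ) (h0 : 0 < p.im) (h1 : p.im < h)
    (U : Set ℂ) (hU : IsOpen U) (hsub : ∀ z : ℂ, 0 ≤ z.im → z.im ≤ h → z ∈ U)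
    (hφ : DifferentiableOn ℂ φ U) (hf : ∀ z, z ∈ U → z ≠ p → f z = φ z / (z - p))
    (hdec : ∀ e > 0, ∃ T : ℝ, ∀ z : ℂ, 0 ≤ z.im → z.im ≤ h → T ≤ |z.re| → ‖f z‖ ≤ e)
    (hi0 : MeasureTheory.Integrable (fun x : ℝ => f x))
    (hi1 : MeasureTheory.Integrable (fun x : ℝ => f (x + h * I))) :
    (∫ x : ℝ, f x) - (∫ x : ℝ, f (x + h * I)) = 2 * Real.pi * I * φ p := by
  have hpU : p ∈ U := hsub p h0.le h1.le
  have hg : DifferentiableOn ℂ (dslope φ p) U :=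
    (differentiableOn_dslope (hU.mem_nhds hpU)).2 hφ
  have hgf : ∀ z ∈ U, z ≠ p → dslope φ p z = f z - φ p * (1 / (z - p)) := by
    intro z hz hzp
    rw [dslope_of_ne _ hzp, slope_def_field, hf z hz hzp]; ring
  have hh : 0 < h := h0.trans h1
  -- Cauchy on rectangles
  have hC : ∀ T : ℝ, (∫ x : ℝ in (p.re - T)..(p.re + T), dslope φ p x) -
      (∫ x : ℝ in (p.re - T)..(p.re + T), dslope φ p (x + h * I)) +
      I * (∫ y : ℝ in (0)..h, dslope φ p (((p.re + T : ℝ) : ℂ) + y * I)) -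
      I * (∫ y : ℝ in (0)..h, dslope φ p (((p.re - T : ℝ) : ℂ) + y * I)) = 0 := by
    intro T
    have := integral_boundary_rect_eq_zero_of_differentiableOn (dslope φ p)
      (((p.re - T : ℝ) : ℂ)) (((p.re + T : ℝ) : ℂ) + h * I) (by
        refine hg.mono ?_
        intro z hz
        rw [mem_reProdIm] at hz
        have h2 := hz.2
        simp only [ofReal_im, add_im, mul_im, ofReal_re, I_im, mul_one, I_re, mul_zero,
          add_zero, zero_add] at h2
        rw [Set.uIcc_of_le hh.le] at h2
        exact hsub z h2.1 h2.2)
    simpa using this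
  have side : ∀ σ : ℝ, |σ| = 1 → Tendsto (fun T : ℝ => ∫ y : ℝ in (0)..h,
      dslope φ p (((p.re + σ * T : ℝ) : ℂ) + y * I)) atTop (𝓝 0) := by
    intro σ hσ
    rw [Metric.tendsto_atTop]
    intro e he
    obtain ⟨T0, hT0⟩ := hdec (e / (4 * h)) (by positivity)
    refine ⟨max 1 (max (T0 + |p.re|) (4 * h * ‖φ p‖ / e)), fun T hT => ?_⟩
    have hT1 : 1 ≤ T := (le_max_left _ _).trans hT
    have hT2 : T0 + |p.re| ≤ T := (le_max_left _ _).trans ((le_max_right _ _).trans hT)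
    have hT3 : 4 * h * ‖φ p‖ / e ≤ T := (le_max_right _ _).trans ((le_max_right _ _).trans hT)
    have hTp : 0 < T := by linarith
    rw [dist_zero_right]
    have habs : |σ * T| = T := by rw [abs_mul, hσ, one_mul, abs_of_pos hTp]
    have hb : ∀ y ∈ Set.uIoc 0 h, ‖dslope φ p (((p.re + σ * T : ℝ) : ℂ) + y * I)‖ ≤ e / (2 * h) := by
      intro y hy
      rw [Set.uIoc_of_le hh.le] at hy
      set z : ℂ := ((p.re + σ * T : ℝ) : ℂ) + y * I with hz
      have zre : z.re = p.re + σ * T := by simp [hz]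
      have zim : z.im = y := by simp [hz]
      have hzre : (z - p).re = σ * T := by rw [sub_re, zre]; ring
      have hn : T ≤ ‖z - p‖ := by
        calc T = |(z - p).re| := by rw [hzre, habs]
          _ ≤ _ := abs_re_le_norm _
      have hzp : z ≠ p := by
        intro hh'
        rw [hh', sub_self, norm_zero] at hn
        linarith
      rw [hgf z (hsub z (by rw [zim]; exact hy.1.le) (by rw [zim]; exact hy.2)) hzp]
      have b1 : ‖f z‖ ≤ e / (4 * h) := by
        apply hT0 z (by rw [zim]; exact hy.1.le) (by rw [zim]; exact hy.2)
        rw [zre]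
        have : |σ * T| ≤ |p.re + σ * T| + |p.re| := by
          calc |σ * T| = |(p.re + σ * T) - p.re| := by ring_nf
            _ ≤ _ := abs_sub _ _
        rw [habs] at this
        linarith
      have b2 : ‖φ p * (1 / (z - p))‖ ≤ e / (4 * h) := by
        rw [norm_mul, norm_div, norm_one, mul_one_div]
        calc ‖φ p‖ / ‖z - p‖ ≤ ‖φ p‖ / T := by gcongr
          _ ≤ e / (4 * h) := by
            rw [div_le_div_iff₀ hTp (by positivity)]
            rw [div_le_iff₀ he] at hT3
            linarith
      calc _ ≤ ‖f z‖ + ‖φ p * (1 / (z - p))‖ := norm_sub_le _ _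
        _ ≤ e / (4 * h) + e / (4 * h) := add_le_add b1 b2
        _ = e / (2 * h) := by field_simp; norm_num
    calc _ ≤ e / (2 * h) * |h - 0| := intervalIntegral.norm_integral_le_of_norm_le_const hb
      _ = e / 2 := by rw [sub_zero, abs_of_pos hh]; field_simp
      _ < e := by linarith
  have lim1 : Tendsto (fun T : ℝ => p.re - T) atTop atBot := by
    simpa [sub_eq_add_neg] using tendsto_atBot_add_const_left atTop p.re tendsto_neg_atTop_atBot
  have lim2 : Tendsto (fun T : ℝ => p.re + T) atTop atTop :=
    tendsto_atTop_add_const_left _ _ tendsto_id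
  have line : ∀ (c : ℝ), (0 ≤ c) → (c ≤ h) → (c ≠ p.im) → ∀ L : ℂ,
      MeasureTheory.Integrable (fun x : ℝ => f (x + c * I)) →
      Tendsto (fun T : ℝ => ∫ y in (-T)..T, (1 : ℂ) / ((y : ℂ) + (c - p.im : ℝ) * I)) atTop (𝓝 L) →
      Tendsto (fun T : ℝ => ∫ x : ℝ in (p.re - T)..(p.re + T), dslope φ p (x + c * I)) atTop
        (𝓝 ((∫ x : ℝ, f (x + c * I)) - φ p * L)) := by
    intro c hc0 hch hcp L hi hL
    have hne : ∀ x : ℝ, (x : ℂ) + c * I ≠ p := by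
      intro x hx
      have := congrArg Complex.im hx
      simp at this
      exact hcp this
    have A := MeasureTheory.intervalIntegral_tendsto_integral hi lim1 lim2
    refine (A.sub (hL.const_mul (φ p))).congr fun T => ?_
    have e1 : ∀ x : ℝ, dslope φ p (x + c * I) = f (x + c * I) - φ p * (1 / ((x + c * I : ℂ) - p)) := by
      intro x
      exact hgf _ (hsub _ (by simpa using hc0) (by simpa using hch)) (hne x)
    simp_rw [e1]
    have hcont : Continuous fun x : ℝ => φ p * (1 / ((x + c * I : ℂ) - p)) := by
      refine continuous_const.mul (continuous_const.div (by fun_prop) ?_)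
      intro x; exact sub_ne_zero.2 (hne x)
    rw [intervalIntegral.integral_sub hi.intervalIntegrable (hcont.intervalIntegrable _ _),
      intervalIntegral.integral_const_mul]
    congr 2
    have := intervalIntegral.integral_comp_add_right (a := -T) (b := T)
      (fun x : ℝ => 1 / ((x + c * I : ℂ) - p)) p.re
    rw [show p.re - T = -T + p.re by ring, show p.re + T = T + p.re by ring, ← this]
    refine intervalIntegral.integral_congr fun y _ => ?_
    congr 1
    push_cast
    linear_combination -(re_add_im p)
  have L0 := line 0 le_rfl hh.le h0.ne (Real.pi * I) (by simpa using hi0) (by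
    refine (aux_lim_pos p.im h0).congr fun T => ?_
    refine intervalIntegral.integral_congr fun y _ => ?_
    simp [sub_eq_add_neg])
  have L1 := line h hh.le le_rfl h1.ne' (-(Real.pi * I)) hi1 (aux_lim_neg (h - p.im) (by linarith))
  have S1 := (side 1 (by simp)).const_mul I
  have S2 := (side (-1) (by simp)).const_mul I
  have tot := ((L0.sub L1).add S1).sub S2
  have tot0 := tot.congr (f₂ := fun _ => (0 : ℂ)) (fun T => by
    rw [← hC T]
    simp [sub_eq_add_neg])
  have := tendsto_nhds_unique tot0 tendsto_const_nhds
  simp only [ofReal_zero, zero_mul, add_zero] at this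
  linear_combination this


/-- continuous functions of at most exponential growth -/
def Gr (f : ℝ → ℂ) : Prop :=
  Continuous f ∧ ∃ C A : ℝ, 0 ≤ C ∧ 0 ≤ A ∧ ∀ v, ‖f v‖ ≤ C * Real.exp (A * |v|)

lemma Gr.mul {f g : ℝ → ℂ} (hf : Gr f) (hg : Gr g) : Gr (fun v => f v * g v) := by
  obtain ⟨cf, C, A, hC, hA, h⟩ := hf
  obtain ⟨cg, C', A', hC', hA', h'⟩ := hg
  refine ⟨cf.mul cg, C * C', A + A', by positivity, by positivity, fun v => ?_⟩
  rw [norm_mul, add_mul, Real.exp_add]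
  calc _ ≤ (C * Real.exp (A * |v|)) * (C' * Real.exp (A' * |v|)) :=
        mul_le_mul (h v) (h' v) (norm_nonneg _) (by positivity)
    _ = _ := by ring

lemma Gr.add {f g : ℝ → ℂ} (hf : Gr f) (hg : Gr g) : Gr (fun v => f v + g v) := by
  obtain ⟨cf, C, A, hC, hA, h⟩ := hf
  obtain ⟨cg, C', A', hC', hA', h'⟩ := hg
  refine ⟨cf.add cg, C + C', A + A', by positivity, by positivity, fun v => ?_⟩
  have e1 : Real.exp (A * |v|) ≤ Real.exp ((A + A') * |v|) := by
    apply Real.exp_le_exp.2; nlinarith [abs_nonneg v]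
  have e2 : Real.exp (A' * |v|) ≤ Real.exp ((A + A') * |v|) := by
    apply Real.exp_le_exp.2; nlinarith [abs_nonneg v]
  calc _ ≤ ‖f v‖ + ‖g v‖ := norm_add_le _ _
    _ ≤ C * Real.exp (A * |v|) + C' * Real.exp (A' * |v|) := add_le_add (h v) (h' v)
    _ ≤ C * Real.exp ((A + A') * |v|) + C' * Real.exp ((A + A') * |v|) := by gcongr
    _ = _ := by ring

lemma Gr.const (c : ℂ) : Gr (fun _ => c) :=
  ⟨continuous_const, ‖c‖, 0, norm_nonneg _, le_rfl, fun v => by simp⟩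

lemma Gr.id : Gr (fun v => (v : ℂ)) :=
  ⟨continuous_ofReal, 1, 1, by simp, by simp, fun v => by
    have := Real.add_one_le_exp |v|
    simp only [norm_real, Real.norm_eq_abs, one_mul]
    linarith⟩

lemma Gr.pow (n : ℕ) : Gr (fun v => (v : ℂ) ^ n) := by
  induction n with
  | zero => simpa using Gr.const 1
  | succ n ih => simpa [pow_succ] using ih.mul Gr.id

lemma Gr.exp (c : ℂ) : Gr (fun v => cexp (c * v)) :=
  ⟨by fun_prop, 1, ‖c‖, by simp, norm_nonneg _, fun v => by
    rw [norm_exp, one_mul]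
    apply Real.exp_le_exp.2
    calc (c * v).re ≤ ‖c * v‖ := re_le_norm _
      _ = ‖c‖ * |v| := by simp⟩

lemma Gr.of_far {f : ℝ → ℂ} (hf : Continuous f) (T C : ℝ)
    (h : ∀ v, T ≤ |v| → ‖f v‖ ≤ C) : Gr f := by
  obtain ⟨B, hB⟩ := (isCompact_Icc (a := -T) (b := T)).exists_bound_of_continuousOn
    hf.continuousOn
  refine ⟨hf, max 0 (max B C), 0, le_max_left _ _, le_rfl, fun v => ?_⟩
  simp only [zero_mul, Real.exp_zero, mul_one]
  by_cases hv : T ≤ |v|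
  · exact (h v hv).trans ((le_max_right _ _).trans (le_max_right _ _))
  · have : v ∈ Set.Icc (-T) T := by
      rw [Set.mem_Icc, ← abs_le]; linarith
    exact (hB v this).trans ((le_max_left _ _).trans (le_max_right _ _))

lemma Gr.integrable {f : ℝ → ℂ} (hf : Gr f) {b : ℝ} (hb : 0 < b) :
    MeasureTheory.Integrable (fun v : ℝ => f v * cexp (-b * (v : ℂ) ^ 2)) := by
  obtain ⟨cf, C, A, hC, hA, h⟩ := hf
  refine MeasureTheory.Integrable.mono'
    ((integrable_exp_neg_mul_sq (half_pos hb)).const_mul (C * Real.exp (A ^ 2 / (2 * b)))) ?_ ?_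
  · exact (Continuous.mul cf (by fun_prop)).aestronglyMeasurable
  · refine Filter.Eventually.of_forall fun v => ?_
    rw [norm_mul]
    have e1 : ‖cexp (-b * (v : ℂ) ^ 2)‖ = Real.exp (-b * v ^ 2) := by
      rw [norm_exp]; congr 1
      have : (-b * (v : ℂ) ^ 2) = ((-b * v ^ 2 : ℝ) : ℂ) := by push_cast; ring
      rw [this, ofReal_re]
    rw [e1]
    calc _ ≤ (C * Real.exp (A * |v|)) * Real.exp (-b * v ^ 2) := by gcongr; exact h v
      _ = C * Real.exp (A * |v| + -b * v ^ 2) := by rw [Real.exp_add]; ring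
      _ ≤ C * Real.exp (A ^ 2 / (2 * b) + -(b / 2) * v ^ 2) := by
        refine mul_le_mul_of_nonneg_left (Real.exp_le_exp.2 ?_) hC
        have : A ^ 2 / (2 * b) + -(b / 2) * v ^ 2 - (A * |v| + -b * v ^ 2) =
          (A - b * |v|) ^ 2 / (2 * b) := by
          rw [← sq_abs v]
          field_simp; ring
        have h2 : 0 ≤ (A - b * |v|) ^ 2 / (2 * b) := by positivity
        linarith
      _ = _ := by rw [Real.exp_add]; ring

noncomputable def hR : ℝ := (Real.sqrt 2)⁻¹
noncomputable def ep : ℂ := hR * (1 - I)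
noncomputable def ep' : ℂ := hR * (1 + I)

lemma hR_pos : 0 < hR := by unfold hR; positivity
lemma hR_sq : hR ^ 2 = 1 / 2 := by unfold hR; rw [inv_pow, Real.sq_sqrt (by norm_num)]; norm_num
lemma hR_lt : hR < 1 := by nlinarith [hR_sq, hR_pos]
lemma hR_gt : 1 / 2 < hR := by nlinarith [hR_sq, hR_pos]
lemma hRC_sq : (hR : ℂ) ^ 2 = 1 / 2 := by rw [← ofReal_pow, hR_sq]; norm_num
lemma ep_sq : ep ^ 2 = -I := by
  unfold ep; rw [mul_pow, hRC_sq]; linear_combination (1/2) * I_sq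
lemma ep'_sq : ep' ^ 2 = I := by
  unfold ep'; rw [mul_pow, hRC_sq]; linear_combination (1/2) * I_sq
lemma ep_mul : ep * ep' = 1 := by
  unfold ep ep'; linear_combination 2 * hRC_sq - (hR : ℂ) ^ 2 * I_sq
lemma ep_ne : ep ≠ 0 := left_ne_zero_of_mul_eq_one ep_mul
lemma norm_ep : ‖ep‖ = 1 := by
  have h : ‖ep‖ ^ 2 = 1 := by rw [← norm_pow, ep_sq]; simp
  nlinarith [norm_nonneg ep]
lemma ep_mul_im (z : ℂ) : (ep * z).im = hR * (z.im - z.re) := by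
  unfold ep; simp; ring

noncomputable def den (θ : ℝ) (y : ℂ) : ℂ := 1 - cexp (-(2 * Real.pi * I * (y - θ)))

lemma den_zero {θ : ℝ} {y : ℂ} (h : den θ y = 0) : ∃ k : ℤ, y = θ + k := by
  unfold den at h
  have h1 : cexp (-(2 * Real.pi * I * (y - θ))) = 1 := by linear_combination -h
  rw [exp_eq_one_iff] at h1
  obtain ⟨k, hk⟩ := h1
  refine ⟨-k, ?_⟩
  have : (2 * Real.pi * I : ℂ) ≠ 0 := two_pi_I_ne_zero
  apply mul_left_cancel₀ this
  push_cast
  linear_combination -hk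

lemma den_far (θ : ℝ) (y : ℂ) (h : 1 ≤ |2 * Real.pi * y.im|) : 1 / 2 ≤ ‖den θ y‖ := by
  unfold den
  have hn : ‖cexp (-(2 * Real.pi * I * (y - θ)))‖ = Real.exp (2 * Real.pi * y.im) := by
    rw [norm_exp]; congr 1
    simp
  have h2 := abs_norm_sub_norm_le (1 : ℂ) (cexp (-(2 * Real.pi * I * (y - θ))))
  rw [hn, norm_one] at h2
  refine le_trans ?_ h2
  have key : (2 : ℝ) ≤ Real.exp 1 := by have := Real.add_one_le_exp (1 : ℝ); linarith
  rcases le_abs'.1 h with h3 | h3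
  · have : Real.exp (2 * Real.pi * y.im) ≤ 1 / 2 := by
      calc _ ≤ Real.exp (-1) := Real.exp_le_exp.2 h3
        _ = (Real.exp 1)⁻¹ := Real.exp_neg 1
        _ ≤ 2⁻¹ := by gcongr
        _ = _ := by norm_num
    rw [le_abs]; left; linarith
  · have : 2 ≤ Real.exp (2 * Real.pi * y.im) := key.trans (Real.exp_le_exp.2 h3)
    rw [le_abs]; right; linarith

lemma den_far' (θ : ℝ) (z : ℂ) (h0 : 0 ≤ z.im) (h1 : z.im ≤ hR) (h : 2 ≤ |z.re|) :
    1 / 2 ≤ ‖den θ (ep * z)‖ := by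
  apply den_far
  rw [ep_mul_im]
  have h3 : 1 ≤ |z.im - z.re| := by
    have := abs_sub_abs_le_abs_sub z.re z.im
    rw [abs_of_nonneg h0, abs_sub_comm] at this
    linarith [hR_lt]
  rw [abs_mul (2 * Real.pi), abs_mul hR, abs_of_pos hR_pos, abs_of_pos (by positivity : (0:ℝ) < 2 * Real.pi)]
  have := Real.pi_gt_three
  have : 1 ≤ hR * |z.im - z.re| * 2 := by nlinarith [hR_gt]
  nlinarith [hR_pos, abs_nonneg (z.im - z.re)]

lemma den_ne {θ : ℝ} {z : ℂ} (h0 : (θ - 1) * hR < z.im) (h1 : z.im < (θ + 1) * hR)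
    (hz : z ≠ θ * ep') : den θ (ep * z) ≠ 0 := by
  intro h
  obtain ⟨k, hk⟩ := den_zero h
  have e : z = (θ + k) * ep' := by
    rw [← hk]; linear_combination -z * ep_mul
  have him : z.im = (θ + k) * hR := by
    rw [e]; unfold ep'; simp
  rw [him] at h0 h1
  have a1 := lt_of_mul_lt_mul_right h0 hR_pos.le
  have a2 := lt_of_mul_lt_mul_right h1 hR_pos.le
  have b1 : (-1 : ℝ) < k := by linarith
  have b2 : (k : ℝ) < 1 := by linarith
  have : k = 0 := by
    have c1 : (-1 : ℤ) < k := by exact_mod_cast b1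
    have c2 : k < 1 := by exact_mod_cast b2
    omega
  apply hz
  rw [e, this]; simp

noncomputable def FF (W : ℝ) (θ : ℝ) (γ : ℂ) (z : ℂ) : ℂ :=
  ((ep * z) ^ 2 - ep * z + γ) * cexp (-(Real.pi * W : ℝ) * z ^ 2) / den θ (ep * z)

lemma den_diff (θ : ℝ) : Differentiable ℂ (fun z => den θ (ep * z)) := by
  unfold den; fun_prop

lemma den_p (θ : ℝ) : den θ (ep * (θ * ep')) = 0 := by
  have : ep * (θ * ep') = θ := by linear_combination θ * ep_mul
  rw [this]; simp [den]

lemma den_deriv (θ : ℝ) : deriv (fun z => den θ (ep * z)) (θ * ep') = 2 * Real.pi * I * ep := by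
  have h : HasDerivAt (fun z => den θ (ep * z)) (2 * Real.pi * I * ep) (θ * ep') := by
    unfold den
    have h1 : HasDerivAt (fun z : ℂ => -(2 * Real.pi * I * (ep * z - θ)))
        (-(2 * Real.pi * I * (ep * 1))) (θ * ep') :=
      ((((hasDerivAt_id _).const_mul ep).sub_const (θ : ℂ)).const_mul (2 * Real.pi * I)).neg
    have h2 := h1.cexp.const_sub 1
    have : ep * (θ * ep') = θ := by linear_combination θ * ep_mul
    rw [this] at h2
    simp only [sub_self, mul_zero, neg_zero, exp_zero] at h2
    exact h2.congr_deriv (by ring)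
  exact h.deriv

lemma norm_gauss (b : ℝ) (z : ℂ) : ‖cexp (-b * z ^ 2)‖ = Real.exp (-b * (z.re ^ 2 - z.im ^ 2)) := by
  rw [norm_exp]; congr 1
  simp [pow_two]

lemma FF_bound (W : ℝ) (hW : 1 ≤ W) (θ : ℝ) (γ : ℂ) (z : ℂ) (h0 : 0 ≤ z.im) (h1 : z.im ≤ hR)
    (h : 2 ≤ |z.re|) :
    ‖FF W θ γ z‖ ≤ (8 * (3 + ‖γ‖) * Real.exp (Real.pi * W)) / z.re ^ 2 := by
  unfold FF
  have hd := den_far' θ z h0 h1 h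
  rw [norm_div, norm_mul, norm_gauss]
  have him : z.im ^ 2 ≤ 1 := by nlinarith [hR_lt]
  have hx : 4 ≤ z.re ^ 2 := by rw [← sq_abs]; nlinarith
  have hpW : 1 ≤ Real.pi * W := by nlinarith [Real.pi_gt_three]
  have hy : ‖ep * z‖ ^ 2 ≤ z.re ^ 2 + 1 := by
    rw [norm_mul, norm_ep, one_mul, ← normSq_eq_norm_sq, normSq_apply]; nlinarith
  have hQ : ‖(ep * z) ^ 2 - ep * z + γ‖ ≤ (3 + ‖γ‖) * (2 + z.re ^ 2) := by
    calc _ ≤ ‖(ep * z) ^ 2‖ + ‖ep * z‖ + ‖γ‖ :=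
          (norm_add_le _ _).trans (by gcongr; exact norm_sub_le _ _)
      _ ≤ _ := by
        rw [norm_pow]
        nlinarith [norm_nonneg γ, sq_nonneg (‖ep * z‖ - 1)]
  set t := Real.pi * W * z.re ^ 2 with ht
  have htx : z.re ^ 2 ≤ t := by nlinarith
  have ht0 : 0 < t := by linarith
  have hE : Real.exp (-(Real.pi * W) * (z.re ^ 2 - z.im ^ 2)) ≤ Real.exp (Real.pi * W) * Real.exp (-t) := by
    rw [← Real.exp_add]
    apply Real.exp_le_exp.2
    rw [ht]; nlinarith
  have hexp : (2 + z.re ^ 2) * Real.exp (-t) ≤ 4 / z.re ^ 2 := by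
    have h4 : (1 + t / 2) ^ 2 ≤ Real.exp t := by
      have := Real.add_one_le_exp (t / 2)
      calc (1 + t / 2) ^ 2 ≤ (Real.exp (t / 2)) ^ 2 := by gcongr; linarith
        _ = Real.exp t := by rw [← Real.exp_nat_mul]; congr 1; push_cast; ring
    rw [Real.exp_neg, ← div_eq_mul_inv, div_le_div_iff₀ (Real.exp_pos _) (by linarith)]
    nlinarith
  calc _ ≤ ((3 + ‖γ‖) * (2 + z.re ^ 2)) * (Real.exp (Real.pi * W) * Real.exp (-t)) / (1 / 2) := by
        gcongr
    _ = 2 * (3 + ‖γ‖) * Real.exp (Real.pi * W) * ((2 + z.re ^ 2) * Real.exp (-t)) := by ring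
    _ ≤ 2 * (3 + ‖γ‖) * Real.exp (Real.pi * W) * (4 / z.re ^ 2) := by gcongr
    _ = _ := by ring

lemma kern_gr (θ : ℝ) (h0 : 0 < θ) (h1 : θ < 1) (c : ℝ) (hc : c = 0 ∨ c = hR) :
    Gr (fun v : ℝ => 1 / den θ (ep * (v + c * I))) := by
  have hc0 : 0 ≤ c := by rcases hc with h | h <;> rw [h]; exact hR_pos.le
  have hc1 : c ≤ hR := by rcases hc with h | h <;> rw [h]; exact hR_pos.le
  refine Gr.of_far (T := 2) (C := 2) ?_ ?_
  · refine continuous_const.div ?_ ?_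
    · unfold den; fun_prop
    · intro v
      apply den_ne
      · simp; nlinarith [hR_pos]
      · simp; nlinarith [hR_pos]
      · intro h
        have := congrArg Complex.im h
        simp [ep'] at this
        rcases hc with h | h
        · rw [h] at this; have : 0 < θ * hR := mul_pos h0 hR_pos
          linarith
        · rw [h] at this; nlinarith [hR_pos]
  · intro v hv
    have := den_far' θ (v + c * I) (by simpa using hc0) (by simpa using hc1) (by simpa using hv)
    rw [norm_div, norm_one]
    rw [div_le_iff₀ (by linarith)]
    linarith

lemma FF_int (W : ℝ) (hW : 1 ≤ W) (θ : ℝ) (h0 : 0 < θ) (h1 : θ < 1) (γ : ℂ) (c : ℝ)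
    (hc : c = 0 ∨ c = hR) :
    MeasureTheory.Integrable (fun v : ℝ => FF W θ γ (v + c * I)) := by
  have hg : Gr (fun v : ℝ => ((ep ^ 2) * ((v : ℂ) ^ 2) + (ep ^ 2 * (2 * c * I) - ep) * (v : ℂ)
      + (-(ep ^ 2 * c ^ 2) - ep * c * I + γ)) * cexp ((-(2 * Real.pi * W * c * I)) * v)
        * (1 / den θ (ep * (v + c * I))) * cexp (Real.pi * W * c ^ 2)) := by
    refine Gr.mul (Gr.mul (Gr.mul ?_ (Gr.exp _)) (kern_gr θ h0 h1 c hc)) (Gr.const _)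
    exact (((Gr.const _).mul (Gr.pow 2)).add ((Gr.const _).mul Gr.id)).add (Gr.const _)
  refine (hg.integrable (b := Real.pi * W) (by positivity)).congr ?_
  refine Filter.Eventually.of_forall fun v => ?_
  simp only [FF]
  have e : cexp (-(Real.pi * W : ℝ) * ((v : ℂ) + c * I) ^ 2) =
      cexp ((-(2 * Real.pi * W * c * I)) * v) * cexp (Real.pi * W * c ^ 2)
        * cexp (-(Real.pi * W : ℝ) * (v : ℂ) ^ 2) := by
    rw [← Complex.exp_add, ← Complex.exp_add]; congr 1
    push_cast
    linear_combination (-(Real.pi : ℂ) * W * c ^ 2) * I_sq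
  rw [e]
  have e2 : (ep * ((v : ℂ) + c * I)) ^ 2 - ep * (v + c * I) + γ = ((ep ^ 2) * ((v : ℂ) ^ 2) + (ep ^ 2 * (2 * c * I) - ep) * (v : ℂ)
      + (-(ep ^ 2 * c ^ 2) - ep * c * I + γ)) := by
    linear_combination (ep ^ 2 * c ^ 2) * I_sq
  rw [e2]
  ring

lemma resid (W : ℝ) (hW : 1 ≤ W) (θ : ℝ) (h0 : 0 < θ) (h1 : θ < 1) (γ : ℂ) :
    (∫ v : ℝ, FF W θ γ v) - (∫ v : ℝ, FF W θ γ (v + hR * I)) =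
      ep' * ((θ : ℂ) ^ 2 - θ + γ) * cexp (-(Real.pi * I * W * θ ^ 2)) := by
  set p : ℂ := θ * ep' with hp
  have him : p.im = θ * hR := by simp [hp, ep']
  set U : Set ℂ := {z | (θ - 1) * hR < z.im} ∩ {z | z.im < (θ + 1) * hR} with hU
  have hUo : IsOpen U := (isOpen_lt continuous_const continuous_im).inter
    (isOpen_lt continuous_im continuous_const)
  have hds : ∀ z ∈ U, dslope (fun z => den θ (ep * z)) p z ≠ 0 := by
    intro z hz
    by_cases hzp : z = p
    · rw [hzp, dslope_same, hp, den_deriv]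
      exact mul_ne_zero two_pi_I_ne_zero ep_ne
    · rw [dslope_of_ne _ hzp, slope_def_field, hp, den_p, sub_zero]
      exact div_ne_zero (den_ne hz.1 hz.2 hzp) (sub_ne_zero.2 hzp)
  have key := strip_residue (fun z => ((ep * z) ^ 2 - ep * z + γ) *
      cexp (-(Real.pi * W : ℝ) * z ^ 2) / dslope (fun z => den θ (ep * z)) p z)
    (FF W θ γ) p hR (by rw [him]; exact mul_pos h0 hR_pos)
    (by rw [him]; nlinarith [hR_pos]) U hUo ?_ ?_ ?_ ?_ ?_ (FF_int W hW θ h0 h1 γ hR (Or.inr rfl))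
  · rw [key]
    rw [dslope_same, hp, den_deriv]
    have e1 : ep * (θ * ep') = θ := by linear_combination θ * ep_mul
    have e2 : -((Real.pi * W : ℝ) : ℂ) * (θ * ep') ^ 2 = -(Real.pi * I * W * θ ^ 2) := by
      push_cast; linear_combination (-(Real.pi : ℂ) * W * θ ^ 2) * ep'_sq
    rw [e1, e2]
    have := two_pi_I_ne_zero
    have h2 := ep_ne
    rw [mul_div_assoc', div_eq_iff (mul_ne_zero this ep_ne)]
    linear_combination (-(2 * Real.pi * I * (((θ : ℂ) ^ 2 - θ + γ) *
      cexp (-(Real.pi * I * W * θ ^ 2))))) * ep_mul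
  · intro z hz0 hz1
    exact ⟨by show _ < z.im; nlinarith [hR_pos], by show z.im < _; nlinarith [hR_pos]⟩
  · refine DifferentiableOn.div (by fun_prop) ?_ hds
    refine (differentiableOn_dslope (hUo.mem_nhds ?_)).2 (den_diff θ).differentiableOn
    exact ⟨by show _ < p.im; rw [him]; nlinarith [hR_pos],
      by show p.im < _; rw [him]; nlinarith [hR_pos]⟩
  · intro z hz hzp
    rw [dslope_of_ne _ hzp, slope_def_field, hp, den_p, sub_zero]
    unfold FF
    have := den_ne hz.1 hz.2 hzp
    have h3 := sub_ne_zero.2 hzp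
    rw [hp] at h3
    field_simp
  · intro e he
    set C := 8 * (3 + ‖γ‖) * Real.exp (Real.pi * W) with hC
    have hC0 : 0 < C := by positivity
    refine ⟨max 2 (C / e), fun z hz0 hz1 hT => ?_⟩
    have hT2 := (le_max_left _ _).trans hT
    have hT3 := (le_max_right _ _).trans hT
    refine (FF_bound W hW θ γ z hz0 hz1 hT2).trans ?_
    rw [← hC, ← sq_abs, div_le_iff₀ (by positivity)]
    rw [div_le_iff₀ he] at hT3
    nlinarith
  · simpa using FF_int W hW θ h0 h1 γ 0 (Or.inl rfl)


noncomputable def Jn (b : ℝ) (c : ℂ) (n : ℕ) : ℂ :=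
  ∫ v : ℝ, (v : ℂ) ^ n * cexp (c * v) * cexp (-b * (v : ℂ) ^ 2)

lemma Jn_int {b : ℝ} (hb : 0 < b) (c : ℂ) (n : ℕ) : MeasureTheory.Integrable
    (fun v : ℝ => (v : ℂ) ^ n * cexp (c * v) * cexp (-b * (v : ℂ) ^ 2)) :=
  ((Gr.pow n).mul (Gr.exp c)).integrable hb

lemma Jn_rec {b : ℝ} (hb : 0 < b) (c : ℂ) (n : ℕ) :
    n * Jn b c (n - 1) + c * Jn b c n - 2 * b * Jn b c (n + 1) = 0 := by
  have i1 := (Jn_int hb c (n - 1)).const_mul (n : ℂ)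
  have i2 := (Jn_int hb c n).const_mul c
  have i3 := (Jn_int hb c (n + 1)).const_mul (2 * b : ℂ)
  have hd : ∀ v : ℝ, HasDerivAt (fun v : ℝ => (v : ℂ) ^ n * cexp (c * v) * cexp (-b * (v : ℂ) ^ 2))
      (n * ((v : ℂ) ^ (n - 1) * cexp (c * v) * cexp (-b * (v : ℂ) ^ 2)) +
        c * ((v : ℂ) ^ n * cexp (c * v) * cexp (-b * (v : ℂ) ^ 2)) -
        2 * b * ((v : ℂ) ^ (n + 1) * cexp (c * v) * cexp (-b * (v : ℂ) ^ 2))) v := by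
    intro v
    have h1 : HasDerivAt (fun z : ℂ => z ^ n * cexp (c * z) * cexp (-b * z ^ 2))
      (n * ((v : ℂ) ^ (n - 1) * cexp (c * v) * cexp (-b * (v : ℂ) ^ 2)) +
        c * ((v : ℂ) ^ n * cexp (c * v) * cexp (-b * (v : ℂ) ^ 2)) -
        2 * b * ((v : ℂ) ^ (n + 1) * cexp (c * v) * cexp (-b * (v : ℂ) ^ 2))) v := by
      have a1 := hasDerivAt_pow n (v : ℂ)
      have a2 : HasDerivAt (fun z : ℂ => cexp (c * z)) (cexp (c * v) * (c * 1)) v :=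
        ((hasDerivAt_id (v : ℂ)).const_mul c).cexp
      have a3 : HasDerivAt (fun z : ℂ => cexp (-b * z ^ 2))
          (cexp (-b * (v : ℂ) ^ 2) * (-b * ((2 : ℕ) * (v : ℂ) ^ (2 - 1)))) v :=
        ((hasDerivAt_pow 2 (v : ℂ)).const_mul (-b : ℂ)).cexp
      refine ((a1.mul a2).mul a3).congr_deriv ?_
      simp only [Pi.mul_apply]
      push_cast
      ring
    exact h1.comp_ofReal
  have this := MeasureTheory.integral_eq_zero_of_hasDerivAt_of_integrable hd ((i1.add i2).sub i3)
    (Jn_int hb c n)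
  rw [← this]
  unfold Jn
  have i12 : MeasureTheory.Integrable (fun v : ℝ =>
      (n : ℂ) * ((v : ℂ) ^ (n - 1) * cexp (c * v) * cexp (-b * (v : ℂ) ^ 2)) +
        c * ((v : ℂ) ^ n * cexp (c * v) * cexp (-b * (v : ℂ) ^ 2))) := i1.add i2
  rw [MeasureTheory.integral_sub i12 i3, MeasureTheory.integral_add i1 i2]
  simp_rw [MeasureTheory.integral_const_mul]

lemma Jn_zero {W : ℝ} (hW : 0 < W) (k : ℂ) :
    (Real.sqrt W : ℂ) * Jn (Real.pi * W) (-(2 * Real.pi * I * k * ep)) 0 =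
      cexp (Real.pi * I * k ^ 2 / W) := by
  unfold Jn
  have h := integral_cexp_quadratic (b := (-(Real.pi * W : ℝ) : ℂ))
    (by rw [neg_re, ofReal_re]; have := Real.pi_pos; nlinarith [mul_pos this hW])
    (-(2 * Real.pi * I * k * ep)) 0
  have e : ∀ v : ℝ, (v : ℂ) ^ 0 * cexp (-(2 * Real.pi * I * k * ep) * v) *
      cexp (-(Real.pi * W : ℝ) * (v : ℂ) ^ 2) =
      cexp (-(Real.pi * W : ℝ) * (v : ℂ) ^ 2 + -(2 * Real.pi * I * k * ep) * v + 0) := by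
    intro v
    rw [pow_zero, one_mul, ← Complex.exp_add]; ring_nf
  simp_rw [e]
  rw [h, ← mul_assoc]
  have e2 : (Real.pi / - -((Real.pi * W : ℝ) : ℂ)) ^ (1 / 2 : ℂ) = ((Real.sqrt W)⁻¹ : ℝ) := by
    have : (Real.pi / - -((Real.pi * W : ℝ) : ℂ)) = ((W⁻¹ : ℝ) : ℂ) := by
      push_cast
      have : (Real.pi : ℂ) ≠ 0 := by exact_mod_cast Real.pi_ne_zero
      have : (W : ℂ) ≠ 0 := by exact_mod_cast hW.ne'
      field_simp
    rw [this, ← Real.sqrt_inv, Real.sqrt_eq_rpow, ofReal_cpow (by positivity)]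
    norm_num
  rw [e2, ← ofReal_mul, mul_inv_cancel₀ (Real.sqrt_pos.2 hW).ne', ofReal_one, one_mul]
  congr 1
  push_cast
  have h1 : (Real.pi : ℂ) ≠ 0 := by exact_mod_cast Real.pi_ne_zero
  have h2 : (W : ℂ) ≠ 0 := by exact_mod_cast hW.ne'
  field_simp
  rw [ep_sq, I_sq]
  ring

noncomputable def kap (W : ℝ) : ℂ := -I / (2 * Real.pi * W)

lemma Jn_weight {W : ℝ} (hW : 0 < W) (k : ℂ) (γ : ℂ) :
    (Real.sqrt W : ℂ) * ∫ v : ℝ, ((ep * v) ^ 2 + ep * v + γ) * cexp (-(2 * Real.pi * I * k * ep) * v) *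
      cexp (-(Real.pi * W : ℝ) * (v : ℂ) ^ 2) =
      cexp (Real.pi * I * k ^ 2 / W) * ((k / W) ^ 2 - k / W + kap W + γ) := by
  have hb : 0 < Real.pi * W := mul_pos Real.pi_pos hW
  set c : ℂ := -(2 * Real.pi * I * k * ep) with hc
  have i0 := (Jn_int hb c 0).const_mul γ
  have i1 := (Jn_int hb c 1).const_mul ep
  have i2 := (Jn_int hb c 2).const_mul (ep ^ 2)
  have e : ∀ v : ℝ, ((ep * v) ^ 2 + ep * v + γ) * cexp (c * v) *
      cexp (-(Real.pi * W : ℝ) * (v : ℂ) ^ 2) =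
      ep ^ 2 * ((v : ℂ) ^ 2 * cexp (c * v) * cexp (-(Real.pi * W : ℝ) * (v : ℂ) ^ 2)) +
      ep * ((v : ℂ) ^ 1 * cexp (c * v) * cexp (-(Real.pi * W : ℝ) * (v : ℂ) ^ 2)) +
      γ * ((v : ℂ) ^ 0 * cexp (c * v) * cexp (-(Real.pi * W : ℝ) * (v : ℂ) ^ 2)) := by
    intro v; ring
  simp_rw [e]
  have i12 : MeasureTheory.Integrable (fun v : ℝ =>
      ep ^ 2 * ((v : ℂ) ^ 2 * cexp (c * v) * cexp (-(Real.pi * W : ℝ) * (v : ℂ) ^ 2)) +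
      ep * ((v : ℂ) ^ 1 * cexp (c * v) * cexp (-(Real.pi * W : ℝ) * (v : ℂ) ^ 2))) := i2.add i1
  rw [MeasureTheory.integral_add i12 i0, MeasureTheory.integral_add i2 i1]
  simp_rw [MeasureTheory.integral_const_mul]
  change (Real.sqrt W : ℂ) * (ep ^ 2 * Jn (Real.pi * W) c 2 + ep * Jn (Real.pi * W) c 1 +
    γ * Jn (Real.pi * W) c 0) = _
  have r0 := Jn_rec hb c 0
  have r1 := Jn_rec hb c 1
  have j0 := Jn_zero hW k
  rw [← hc] at j0
  simp only [Nat.cast_zero, zero_mul, zero_add, Nat.cast_one, one_mul, Nat.sub_self,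
    show 1 + 1 = 2 from rfl] at r0 r1
  have hp : (Real.pi : ℂ) ≠ 0 := by exact_mod_cast Real.pi_ne_zero
  have hw : (W : ℂ) ≠ 0 := by exact_mod_cast hW.ne'
  rw [← j0]
  have s1 : ep * Jn (Real.pi * W) c 1 = -(k / W) * Jn (Real.pi * W) c 0 := by
    have : (2 * (Real.pi * W) : ℂ) ≠ 0 := by simp [hp, hw]
    apply mul_left_cancel₀ this
    push_cast at r0
    have : 2 * (Real.pi * W : ℂ) * (-(k / W) * Jn (Real.pi * W) c 0) =
      -(2 * Real.pi * k) * Jn (Real.pi * W) c 0 := by field_simp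
    rw [this]
    rw [hc] at r0 ⊢
    linear_combination (-ep) * r0 - 2 * Real.pi * k * Jn (Real.pi * W) (-(2 * Real.pi * I * k * ep)) 0 * I * ep_sq + 2 * Real.pi * k * Jn (Real.pi * W) (-(2 * Real.pi * I * k * ep)) 0 * I_sq
  have s2 : ep ^ 2 * Jn (Real.pi * W) c 2 = ((k / W) ^ 2 + kap W) * Jn (Real.pi * W) c 0 := by
    have : (2 * (Real.pi * W) : ℂ) ≠ 0 := by simp [hp, hw]
    apply mul_left_cancel₀ this
    push_cast at r1
    have : 2 * (Real.pi * W : ℂ) * (((k / W) ^ 2 + kap W) * Jn (Real.pi * W) c 0) =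
      (2 * Real.pi * k ^ 2 / W - I) * Jn (Real.pi * W) c 0 := by
      unfold kap; field_simp; ring
    rw [this]
    have s3 : ep ^ 2 * (c * Jn (Real.pi * W) c 1) = (2 * Real.pi * k ^ 2 / W) * Jn (Real.pi * W) c 0 := by
      calc ep ^ 2 * (c * Jn (Real.pi * W) c 1) = ep * c * (ep * Jn (Real.pi * W) c 1) := by ring
        _ = (-(2 * Real.pi * k)) * (ep * Jn (Real.pi * W) c 1) := by
          congr 1
          rw [hc]; linear_combination (-(2 * Real.pi * I * k)) * ep_sq + 2 * Real.pi * k * I_sq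
        _ = _ := by rw [s1]; ring
    linear_combination (-ep ^ 2) * r1 + s3 + Jn (Real.pi * W) c 0 * ep_sq
  rw [s1, s2]
  ring


lemma ep'_eq : ep' = I * ep := by
  unfold ep ep'; linear_combination (-(hR : ℂ)) * (-I_sq)

lemma FF_shift (W : ℕ) (hev : Even W) (θ : ℝ) (γ : ℂ) (v : ℝ) :
    FF W θ γ ((v + hR : ℝ) + hR * I) =
      ((ep * v) ^ 2 + ep * v + γ) * (1 / den θ (ep * v)) * cexp (-(2 * Real.pi * I * W * (ep * v))) *
        cexp (-(Real.pi * W : ℝ) * (v : ℂ) ^ 2) := by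
  have h1 : (((v + hR : ℝ) : ℂ) + hR * I) = v + ep' := by unfold ep'; push_cast; ring
  rw [h1]
  unfold FF
  have h2 : ep * (v + ep') = ep * v + 1 := by rw [mul_add, ep_mul]
  have h3 : den θ (ep * v + 1) = den θ (ep * v) := by
    unfold den
    congr 1
    rw [show -(2 * (Real.pi : ℂ) * I * (ep * v + 1 - θ)) = -(2 * Real.pi * I * (ep * v - θ)) - 2 * Real.pi * I by ring]
    rw [Complex.exp_sub, exp_two_pi_mul_I, div_one]
  have h4 : cexp (-(Real.pi * W : ℝ) * (v + ep') ^ 2) =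
      cexp (-(2 * Real.pi * I * W * (ep * v))) * cexp (-(Real.pi * W : ℝ) * (v : ℂ) ^ 2) := by
    obtain ⟨r, hr⟩ := hev
    have : cexp (-(Real.pi * W : ℝ) * (v + ep') ^ 2) = 
      cexp (-(2 * Real.pi * I * W * (ep * v))) * cexp (-(Real.pi * W : ℝ) * (v : ℂ) ^ 2) *
        cexp ((-(r : ℤ) : ℤ) * (2 * Real.pi * I)) := by
      rw [← Complex.exp_add, ← Complex.exp_add]
      congr 1
      have e1 := ep'_sq
      have e2 := ep'_eq
      have e3 : (W : ℂ) = r + r := by rw [hr]; push_cast; ring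
      push_cast
      linear_combination (-(Real.pi * W) : ℂ) * e1 - 2 * Real.pi * W * v * e2 - Real.pi * I * e3
    rw [this, exp_int_mul_two_pi_mul_I, mul_one]
  rw [h2, h3, h4]
  ring

lemma geom_den (W : ℕ) (θ : ℝ) (z : ℤ) (hz : W * θ = z) (y : ℂ) (hy : den θ y ≠ 0) :
    ∑ k ∈ range W, cexp (2 * Real.pi * I * k * θ) * cexp (-(2 * Real.pi * I * k * y)) =
      (1 - cexp (-(2 * Real.pi * I * W * y))) * (1 / den θ y) := by
  have h1 : ∀ k : ℕ, cexp (2 * Real.pi * I * k * θ) * cexp (-(2 * Real.pi * I * k * y)) =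
      cexp (-(2 * Real.pi * I * (y - θ))) ^ k := by
    intro k
    rw [← Complex.exp_add, ← Complex.exp_nat_mul]; congr 1; ring
  simp_rw [h1]
  have h2 : cexp (-(2 * Real.pi * I * (y - θ))) ^ W = cexp (-(2 * Real.pi * I * W * y)) := by
    rw [← Complex.exp_nat_mul]
    have hz' : (W : ℂ) * θ = z := by exact_mod_cast hz
    rw [show (W : ℂ) * -(2 * Real.pi * I * (y - θ)) = -(2 * Real.pi * I * W * y) + z * (2 * Real.pi * I) by
      linear_combination (2 * Real.pi * I) * hz']
    rw [Complex.exp_add, exp_int_mul_two_pi_mul_I, mul_one]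
  have h3 := mul_neg_geom_sum (cexp (-(2 * Real.pi * I * (y - θ)))) W
  rw [h2] at h3
  rw [← h3]
  unfold den at hy ⊢
  field_simp

lemma den_line_ne (θ : ℝ) (h0 : 0 < θ) (h1 : θ < 1) (v : ℝ) : den θ (ep * v) ≠ 0 := by
  apply den_ne
  · simp; nlinarith [hR_pos]
  · simp; nlinarith [hR_pos]
  · intro h
    have := congrArg Complex.im h
    simp [ep'] at this
    rcases this with h | h
    · linarith
    · linarith [hR_pos]

lemma theta_id (W : ℕ) (hW : 0 < W) (hev : Even W) (θ : ℝ) (h0 : 0 < θ) (h1 : θ < 1)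
    (z : ℤ) (hz : W * θ = z) (γ : ℂ) :
    ∑ k ∈ range W, cexp (2 * Real.pi * I * k * θ) *
        (cexp (Real.pi * I * k ^ 2 / W) * (((k : ℂ) / W) ^ 2 - k / W + kap W + γ)) =
      (Real.sqrt W : ℂ) * (2 * (∫ v : ℝ, (ep * v) * (1 / den θ (ep * v)) *
        cexp (-(Real.pi * W : ℝ) * (v : ℂ) ^ 2)) +
        ep' * ((θ : ℂ) ^ 2 - θ + γ) * cexp (-(Real.pi * I * W * θ ^ 2))) := by
  have hWr : (0 : ℝ) < W := by exact_mod_cast hW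
  have hW1 : (1 : ℝ) ≤ W := by exact_mod_cast hW
  have hb : 0 < Real.pi * W := mul_pos Real.pi_pos hWr
  have hgQ : Gr (fun v : ℝ => (ep * v) ^ 2 + ep * v + γ) := by
    have : Gr (fun v : ℝ => ep ^ 2 * (v : ℂ) ^ 2 + ep * v + γ) :=
      (((Gr.const _).mul (Gr.pow 2)).add ((Gr.const _).mul Gr.id)).add (Gr.const _)
    simpa only [mul_pow] using this
  have hJ : ∀ k : ℕ, cexp (2 * Real.pi * I * k * θ) *
        (cexp (Real.pi * I * k ^ 2 / W) * (((k : ℂ) / W) ^ 2 - k / W + kap W + γ)) =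
        (Real.sqrt W : ℂ) * ∫ v : ℝ, cexp (2 * Real.pi * I * k * θ) * (((ep * v) ^ 2 + ep * v + γ) *
          cexp (-(2 * Real.pi * I * k * ep) * v) *
          cexp (-(Real.pi * W : ℝ) * (v : ℂ) ^ 2)) := by
    intro k
    have := Jn_weight hWr (k : ℂ) γ
    rw [MeasureTheory.integral_const_mul]
    simp only [ofReal_natCast] at this ⊢
    rw [← this]; ring
  simp_rw [hJ]
  rw [← Finset.mul_sum, ← MeasureTheory.integral_finsetSum]
  swap
  · intro k _
    exact ((hgQ.mul (Gr.exp _)).integrable hb).const_mul _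
  congr 1
  have hk := kern_gr θ h0 h1 0 (Or.inl rfl)
  simp only [ofReal_zero, zero_mul, add_zero] at hk
  have iA : MeasureTheory.Integrable (fun v : ℝ => FF W θ γ v) := by
    have := FF_int W hW1 θ h0 h1 γ 0 (Or.inl rfl)
    simpa using this
  have iB : MeasureTheory.Integrable (fun v : ℝ => (ep * v) * (1 / den θ (ep * v)) *
        cexp (-(Real.pi * W : ℝ) * (v : ℂ) ^ 2)) :=
    ((((Gr.const ep).mul Gr.id)).mul hk).integrable hb
  have iC : MeasureTheory.Integrable (fun v : ℝ => FF W θ γ ((v + hR : ℝ) + hR * I)) :=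
    (FF_int W hW1 θ h0 h1 γ hR (Or.inr rfl)).comp_add_right hR
  have pt : ∀ v : ℝ, ∑ k ∈ range W, cexp (2 * Real.pi * I * k * θ) * (((ep * v) ^ 2 + ep * v + γ) *
          cexp (-(2 * Real.pi * I * k * ep) * v) *
          cexp (-(Real.pi * W : ℝ) * (v : ℂ) ^ 2)) =
        (FF W θ γ v + 2 * ((ep * v) * (1 / den θ (ep * v)) *
        cexp (-(Real.pi * W : ℝ) * (v : ℂ) ^ 2))) - FF W θ γ ((v + hR : ℝ) + hR * I) := by
    intro v
    rw [FF_shift W hev]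
    have hg := geom_den W θ z hz (ep * v) (den_line_ne θ h0 h1 v)
    calc _ = (∑ k ∈ range W, cexp (2 * Real.pi * I * k * θ) * cexp (-(2 * Real.pi * I * k * (ep * v)))) *
          (((ep * v) ^ 2 + ep * v + γ) * cexp (-(Real.pi * W : ℝ) * (v : ℂ) ^ 2)) := by
          rw [Finset.sum_mul]
          refine Finset.sum_congr rfl fun k _ => ?_
          rw [show -(2 * (Real.pi : ℂ) * I * k * ep) * v = -(2 * Real.pi * I * k * (ep * v)) by ring]
          ring
      _ = _ := by
          rw [hg]
          unfold FF
          ring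
  simp_rw [pt]
  have iAB : MeasureTheory.Integrable (fun v : ℝ => FF W θ γ v + 2 * ((ep * v) * (1 / den θ (ep * v)) *
        cexp (-(Real.pi * W : ℝ) * (v : ℂ) ^ 2))) := iA.add (iB.const_mul 2)
  rw [MeasureTheory.integral_sub iAB iC, MeasureTheory.integral_add iA (iB.const_mul 2),
    MeasureTheory.integral_const_mul]
  have tr := MeasureTheory.integral_add_right_eq_self (μ := MeasureTheory.volume)
    (fun v : ℝ => FF W θ γ (v + hR * I)) hR
  have hres := resid W hW1 θ h0 h1 γ
  rw [← tr] at hres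
  simp only [ofReal_natCast] at hres ⊢
  rw [← hres]
  ring


noncomputable def rF (M : ℕ) (c : ℕ → ℂ) (j : ℕ) : ℂ :=
  (1 / M : ℂ) * ∑ l ∈ range M, c l * cexp (-(2 * Real.pi * I * l * (j / M)))

noncomputable def Hk (M : ℕ) (c : ℕ → ℂ) (y : ℂ) : ℂ :=
  ∑ j ∈ Ico 1 M, rF M c j * (1 / den ((j : ℝ) / M) y)

lemma orth (M : ℕ) (hM : 0 < M) (k l : ℕ) (hk : k < M) (hl : l < M) :
    ∑ j ∈ range M, cexp (2 * Real.pi * I * k * (j / M)) * cexp (-(2 * Real.pi * I * l * (j / M))) =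
      if k = l then (M : ℂ) else 0 := by
  have hM0 : (M : ℂ) ≠ 0 := by exact_mod_cast hM.ne'
  split_ifs with h
  · subst h
    simp_rw [← Complex.exp_add, add_neg_cancel, Complex.exp_zero]
    simp
  · have h1 : ∀ j : ℕ, cexp (2 * Real.pi * I * k * (j / M)) * cexp (-(2 * Real.pi * I * l * (j / M))) =
        cexp (2 * Real.pi * I * (((k : ℂ) - l) / M)) ^ j := by
      intro j
      rw [← Complex.exp_add, ← Complex.exp_nat_mul]; congr 1; ring
    simp_rw [h1]
    have h2 : cexp (2 * Real.pi * I * (((k : ℂ) - l) / M)) ^ M = 1 := by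
      rw [← Complex.exp_nat_mul]
      rw [show (M : ℂ) * (2 * Real.pi * I * (((k : ℂ) - l) / M)) = ((k - l : ℤ) : ℂ) * (2 * Real.pi * I) by
        push_cast; field_simp]
      exact exp_int_mul_two_pi_mul_I _
    have h3 : cexp (2 * Real.pi * I * (((k : ℂ) - l) / M)) ≠ 1 := by
      intro he
      rw [Complex.exp_eq_one_iff] at he
      obtain ⟨q, hq⟩ := he
      have hq2 : ((k : ℂ) - l) / M = q := by
        have : (2 * Real.pi * I : ℂ) ≠ 0 := two_pi_I_ne_zero
        apply mul_left_cancel₀ this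
        rw [hq]; ring
      rw [div_eq_iff hM0] at hq2
      have hq3 : (k : ℤ) - l = q * M := by exact_mod_cast hq2
      have : (M : ℤ) ∣ (k : ℤ) - l := ⟨q, by rw [hq3]; ring⟩
      have h5 := Int.eq_zero_of_abs_lt_dvd this (by rw [abs_lt]; omega)
      omega
    have h4 := mul_neg_geom_sum (cexp (2 * Real.pi * I * (((k : ℂ) - l) / M))) M
    rw [h2, sub_self] at h4
    rcases mul_eq_zero.1 h4 with h | h
    · exact absurd (sub_eq_zero.1 h).symm h3
    · exact h

lemma fourier_lt (M : ℕ) (hM : 0 < M) (c : ℕ → ℂ) (k : ℕ) (hk : k < M) :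
    ∑ j ∈ range M, rF M c j * cexp (2 * Real.pi * I * k * (j / M)) = c k := by
  have hM0 : (M : ℂ) ≠ 0 := by exact_mod_cast hM.ne'
  unfold rF
  calc _ = (1 / M : ℂ) * ∑ l ∈ range M, c l * ∑ j ∈ range M, cexp (2 * Real.pi * I * k * (j / M)) * cexp (-(2 * Real.pi * I * l * (j / M))) := by
        simp_rw [Finset.mul_sum, Finset.sum_mul]
        rw [Finset.sum_comm]
        refine Finset.sum_congr rfl fun l _ => Finset.sum_congr rfl fun j _ => ?_
        ring
    _ = (1 / M : ℂ) * ∑ l ∈ range M, c l * if k = l then (M : ℂ) else 0 := by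
        congr 1
        refine Finset.sum_congr rfl fun l hl => ?_
        rw [orth M hM k l hk (Finset.mem_range.1 hl)]
    _ = _ := by
        simp only [mul_ite, mul_zero]
        rw [Finset.sum_ite_eq, if_pos (Finset.mem_range.2 hk)]
        field_simp

lemma fourier_per (M : ℕ) (hM : 0 < M) (c : ℕ → ℂ) (hc : Function.Periodic c M) (k : ℕ) :
    ∑ j ∈ range M, rF M c j * cexp (2 * Real.pi * I * k * (j / M)) = c k := by
  have hM0 : (M : ℂ) ≠ 0 := by exact_mod_cast hM.ne'
  rw [← hc.map_mod_nat k, ← fourier_lt M hM c (k % M) (Nat.mod_lt _ hM)]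
  refine Finset.sum_congr rfl fun j _ => ?_
  congr 1
  have : (k : ℂ) = (k % M : ℕ) + M * (k / M : ℕ) := by exact_mod_cast (Nat.mod_add_div k M).symm
  rw [this]
  generalize k / M = q
  generalize k % M = r
  rw [show 2 * (Real.pi : ℂ) * I * ((r : ℂ) + M * (q : ℂ)) * (j / M) =
    2 * (Real.pi : ℂ) * I * (r : ℂ) * (j / M) + ((q * j : ℕ) : ℤ) * (2 * Real.pi * I) by
      push_cast; field_simp]
  rw [Complex.exp_add, exp_int_mul_two_pi_mul_I, mul_one]

lemma rF_zero (M : ℕ) (c : ℕ → ℂ) (h : ∑ l ∈ range M, c l = 0) : rF M c 0 = 0 := by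
  simp [rF, h]

lemma fourier_per' (M : ℕ) (hM : 0 < M) (c : ℕ → ℂ) (hc : Function.Periodic c M)
    (h : ∑ l ∈ range M, c l = 0) (k : ℕ) :
    c k = ∑ j ∈ Ico 1 M, rF M c j * cexp (2 * Real.pi * I * k * (j / M)) := by
  rw [← fourier_per M hM c hc k, Finset.range_eq_Ico, Finset.sum_eq_sum_Ico_succ_bot hM, rF_zero M c h]
  simp

lemma theta_mem (M : ℕ) (j : ℕ) (hj : j ∈ Ico 1 M) : 0 < (j : ℝ) / M ∧ (j : ℝ) / M < 1 := by
  rw [Finset.mem_Ico] at hj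
  have h1 : (0 : ℝ) < j := by exact_mod_cast hj.1
  have h2 : (j : ℝ) < M := by exact_mod_cast hj.2
  have h3 : (0 : ℝ) < M := h1.trans h2
  exact ⟨by positivity, by rwa [div_lt_one h3]⟩

lemma Hk_eq (M : ℕ) (hM : 0 < M) (c : ℕ → ℂ) (hc : Function.Periodic c M)
    (h : ∑ l ∈ range M, c l = 0) (v : ℝ) :
    (1 - cexp (-(2 * Real.pi * I * M * (ep * v)))) * Hk M c (ep * v) =
      ∑ l ∈ range M, c l * cexp (-(2 * Real.pi * I * l * (ep * v))) := by
  have hM0 : (M : ℝ) ≠ 0 := by exact_mod_cast hM.ne'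
  unfold Hk
  rw [Finset.mul_sum]
  have : ∀ j ∈ Ico 1 M, (1 - cexp (-(2 * Real.pi * I * M * (ep * v)))) *
      (rF M c j * (1 / den ((j : ℝ) / M) (ep * v))) =
      ∑ k ∈ range M, rF M c j * cexp (2 * Real.pi * I * k * (j / M)) *
        cexp (-(2 * Real.pi * I * k * (ep * v))) := by
    intro j hj
    obtain ⟨h0, h1⟩ := theta_mem M j hj
    have := geom_den M ((j : ℝ) / M) j (by push_cast; field_simp) (ep * v) (den_line_ne _ h0 h1 v)
    calc _ = rF M c j * ((1 - cexp (-(2 * Real.pi * I * M * (ep * v)))) * (1 / den ((j : ℝ) / M) (ep * v))) := by ring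
      _ = _ := by
        rw [← this, Finset.mul_sum]
        refine Finset.sum_congr rfl fun k _ => ?_
        push_cast
        ring
  rw [Finset.sum_congr rfl this, Finset.sum_comm]
  refine Finset.sum_congr rfl fun k _ => ?_
  rw [fourier_per' M hM c hc h k, Finset.sum_mul]

lemma phi_split (M : ℕ) (hM : 0 < M) (hev : Even M) (c : ℕ → ℂ) (hc : Function.Periodic c M)
    (h : ∑ l ∈ range M, c l = 0) (N : ℕ) (hN : 0 < N) (W : ℕ) (hW : W = M * N) :
    ∑ k ∈ range W, c k * cexp (Real.pi * I * k ^ 2 / W) * (((k : ℂ) / W) ^ 2 - k / W + 1 / 6) =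
     (Real.sqrt W : ℂ) * (2 * (∫ v : ℝ, (ep * v) * Hk M c (ep * v) *
        cexp (-(Real.pi * W : ℝ) * (v : ℂ) ^ 2)) +
        ep' * ∑ j ∈ Ico 1 M, rF M c j * (((j : ℂ) / M) ^ 2 - j / M + (1 / 6 - kap W)) *
          cexp (-(Real.pi * I * W * ((j : ℂ) / M) ^ 2))) := by
  have hM0 : (M : ℝ) ≠ 0 := by exact_mod_cast hM.ne'
  have hWpos : 0 < W := by rw [hW]; positivity
  have hWr : (0 : ℝ) < W := by exact_mod_cast hWpos
  have hb : 0 < Real.pi * W := mul_pos Real.pi_pos hWr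
  have key : ∀ j ∈ Ico 1 M, rF M c j * ∑ k ∈ range W, cexp (2 * Real.pi * I * k * (j / M)) *
        (cexp (Real.pi * I * k ^ 2 / W) * (((k : ℂ) / W) ^ 2 - k / W + 1 / 6)) =
        (Real.sqrt W : ℂ) * (2 * (∫ v : ℝ, rF M c j * ((ep * v) * (1 / den ((j : ℝ) / M) (ep * v)) *
        cexp (-(Real.pi * W : ℝ) * (v : ℂ) ^ 2))) + ep' * (rF M c j * (((j : ℂ) / M) ^ 2 - j / M + (1 / 6 - kap W)) *
          cexp (-(Real.pi * I * W * ((j : ℂ) / M) ^ 2)))) := by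
    intro j hj
    obtain ⟨h0, h1⟩ := theta_mem M j hj
    have := theta_id W hWpos (by rw [hW]; exact hev.mul_right N) ((j : ℝ) / M) h0 h1 (j * N : ℤ)
      (by rw [hW]; push_cast; field_simp) (1 / 6 - kap W)
    rw [MeasureTheory.integral_const_mul]
    push_cast at this ⊢
    simp only [add_assoc, add_sub_cancel] at this ⊢
    rw [this]
    ring
  calc _ = ∑ j ∈ Ico 1 M, rF M c j * ∑ k ∈ range W, cexp (2 * Real.pi * I * k * (j / M)) *
        (cexp (Real.pi * I * k ^ 2 / W) * (((k : ℂ) / W) ^ 2 - k / W + 1 / 6)) := by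
        simp_rw [Finset.mul_sum]
        rw [Finset.sum_comm]
        refine Finset.sum_congr rfl fun k _ => ?_
        rw [fourier_per' M hM c hc h k, Finset.sum_mul, Finset.sum_mul]
        refine Finset.sum_congr rfl fun j _ => ?_
        ring
    _ = _ := by
        rw [Finset.sum_congr rfl key, ← Finset.mul_sum]
        congr 1
        rw [Finset.sum_add_distrib, ← Finset.mul_sum, ← Finset.mul_sum]
        congr 2
        rw [← MeasureTheory.integral_finsetSum]
        · refine MeasureTheory.integral_congr_ae (Filter.Eventually.of_forall fun v => ?_)
          simp only [Hk, Finset.mul_sum, Finset.sum_mul]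
          refine Finset.sum_congr rfl fun j _ => ?_
          ring
        · intro j hj
          obtain ⟨h0, h1⟩ := theta_mem M j hj
          have hk := kern_gr _ h0 h1 0 (Or.inl rfl)
          simp only [ofReal_zero, zero_mul, add_zero] at hk
          exact ((((Gr.const ep).mul Gr.id).mul hk).integrable hb).const_mul _


/-- `f` has asymptotic (Taylor) expansion `p` at `0`. -/
def Tay (f : ℂ → ℂ) (p : PowerSeries ℂ) : Prop :=
  ∀ m : ℕ, (fun u => f u - (PowerSeries.trunc m p).eval u) =O[nhds 0] (fun u => u ^ m)

lemma eval_tr (m : ℕ) (p : PowerSeries ℂ) (u : ℂ) : (PowerSeries.trunc m p).eval u =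
    ∑ i ∈ range m, PowerSeries.coeff i p * u ^ i := by
  have := PowerSeries.eval₂_trunc_eq_sum_range u (RingHom.id ℂ) m p
  simpa [Polynomial.eval₂_id] using this

lemma poly_isBigO (P : Polynomial ℂ) (m : ℕ) (h : ∀ d < m, P.coeff d = 0) :
    (fun u => P.eval u) =O[nhds 0] (fun u : ℂ => u ^ m) := by
  obtain ⟨Q, rfl⟩ := Polynomial.X_pow_dvd_iff.2 h
  simp only [Polynomial.eval_mul, Polynomial.eval_pow, Polynomial.eval_X]
  have : (fun u => Q.eval u) =O[nhds 0] (fun _ : ℂ => (1 : ℂ)) :=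
    (Polynomial.continuous Q).continuousAt.isBigO_one ℂ
  simpa using (Asymptotics.isBigO_refl (fun u : ℂ => u ^ m) (nhds 0)).mul this

lemma Tay.poly (P : Polynomial ℂ) : Tay (fun u => P.eval u) (P : PowerSeries ℂ) := by
  intro m
  have := poly_isBigO (P - PowerSeries.trunc m (P : PowerSeries ℂ)) m (by
    intro d hd
    rw [Polynomial.coeff_sub, PowerSeries.coeff_trunc, if_pos hd]; simp)
  simpa using this

lemma Tay.bdd {f : ℂ → ℂ} {p : PowerSeries ℂ} (h : Tay f p) : f =O[nhds 0] (fun _ : ℂ => (1 : ℂ)) := by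
  have := h 0
  simpa using this

lemma Tay.add {f g : ℂ → ℂ} {p q : PowerSeries ℂ} (hf : Tay f p) (hg : Tay g q) :
    Tay (fun u => f u + g u) (p + q) := by
  intro m
  refine ((hf m).add (hg m)).congr_left fun u => ?_
  rw [map_add, Polynomial.eval_add]; ring

lemma Tay.mul {f g : ℂ → ℂ} {p q : PowerSeries ℂ} (hf : Tay f p) (hg : Tay g q) :
    Tay (fun u => f u * g u) (p * q) := by
  intro m
  have hG : (fun u => (PowerSeries.trunc m q).eval u) =O[nhds 0] (fun _ : ℂ => (1 : ℂ)) :=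
    (Polynomial.continuous _).continuousAt.isBigO_one ℂ
  have h1 := hf.bdd.mul (hg m)
  have h2 := (hf m).mul hG
  have h3 := poly_isBigO (PowerSeries.trunc m p * PowerSeries.trunc m q - PowerSeries.trunc m (p * q)) m (by
    intro d hd
    rw [Polynomial.coeff_sub, PowerSeries.coeff_trunc, if_pos hd,
      PowerSeries.coeff_mul_eq_coeff_trunc_mul_trunc p q hd, ← Polynomial.coe_mul,
      Polynomial.coeff_coe, sub_self])
  simp only [one_mul, mul_one] at h1 h2
  refine ((h1.add h2).add h3).congr_left fun u => ?_
  simp only [Polynomial.eval_sub, Polynomial.eval_mul]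
  ring

lemma Tay.const (c : ℂ) : Tay (fun _ => c) (PowerSeries.C c) := by
  have := Tay.poly (Polynomial.C c)
  simpa using this

lemma Tay.id : Tay (fun u => u) PowerSeries.X := by
  have := Tay.poly Polynomial.X
  simpa using this

lemma Tay.exp (a : ℂ) : Tay (fun u => cexp (a * u)) (PowerSeries.rescale a (PowerSeries.exp ℂ)) := by
  intro m
  have ht : Filter.Tendsto (fun u : ℂ => a * u) (nhds 0) (nhds 0) := by
    have : Continuous (fun u : ℂ => a * u) := by fun_prop
    simpa using this.tendsto 0
  have h1 := (Complex.exp_sub_sum_range_isBigO_pow m).comp_tendsto ht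
  have h2 : ((fun u : ℂ => u ^ m) ∘ fun u : ℂ => a * u) =O[nhds 0] (fun u : ℂ => u ^ m) := by
    simp only [Function.comp_def, mul_pow]
    exact Asymptotics.isBigO_const_mul_self _ _ _
  refine (h1.trans h2).congr_left fun u => ?_
  simp only [Function.comp_def]
  rw [eval_tr]
  congr 1
  refine Finset.sum_congr rfl fun i _ => ?_
  simp [PowerSeries.coeff_rescale, PowerSeries.coeff_exp, mul_pow]
  ring

lemma Tay.sum {ι : Type*} (s : Finset ι) (f : ι → ℂ → ℂ) (p : ι → PowerSeries ℂ)
    (h : ∀ i ∈ s, Tay (f i) (p i)) : Tay (fun u => ∑ i ∈ s, f i u) (∑ i ∈ s, p i) := by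
  classical
  induction s using Finset.induction_on with
  | empty => simpa using Tay.const 0
  | insert a s ha ih =>
    simp only [Finset.sum_insert ha]
    exact (h a (Finset.mem_insert_self _ _)).add (ih fun i hi => h i (Finset.mem_insert_of_mem hi))

/-- `β_n = Σ c(l) B_n(l/M)` -/
noncomputable def bet (M : ℕ) (c : ℕ → ℂ) (n : ℕ) : ℂ :=
  ∑ l ∈ range M, c l * (((Polynomial.bernoulli n).eval ((l : ℚ) / M) : ℚ) : ℂ)

noncomputable def tau (M : ℕ) (c : ℕ → ℂ) (n : ℕ) : ℂ :=
  bet M c n * (-M) ^ n / (M * n.factorial)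

lemma gen_id (M : ℕ) (hM : 0 < M) (l : ℕ) :
    (PowerSeries.X : PowerSeries ℂ) * PowerSeries.rescale (-(l : ℂ)) (PowerSeries.exp ℂ) =
    (1 - PowerSeries.rescale (-(M : ℂ)) (PowerSeries.exp ℂ)) *
      PowerSeries.mk (fun n => (((Polynomial.bernoulli n).eval ((l : ℚ) / M) : ℚ) : ℂ) * (-M) ^ n / (M * n.factorial)) := by
  have hM0 : (M : ℂ) ≠ 0 := by exact_mod_cast hM.ne'
  have h := congrArg (PowerSeries.rescale (-(M : ℂ))) (Polynomial.bernoulli_generating_function ((l : ℂ) / M))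
  rw [map_mul, map_mul, map_sub, map_one, PowerSeries.rescale_rescale, PowerSeries.rescale_X] at h
  have e1 : (l : ℂ) / M * -M = -l := by field_simp
  rw [e1] at h
  have e2 : PowerSeries.rescale (-(M : ℂ)) (PowerSeries.mk fun n => Polynomial.aeval ((l : ℂ) / M) ((1 / n.factorial : ℚ) • Polynomial.bernoulli n)) =
     PowerSeries.C (M : ℂ) * PowerSeries.mk (fun n => (((Polynomial.bernoulli n).eval ((l : ℚ) / M) : ℚ) : ℂ) * (-M) ^ n / (M * n.factorial)) := by
    ext n
    rw [PowerSeries.coeff_rescale, PowerSeries.coeff_C_mul, PowerSeries.coeff_mk, PowerSeries.coeff_mk]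
    have e3 : Polynomial.aeval ((l : ℂ) / M) (Polynomial.bernoulli n) = (((Polynomial.bernoulli n).eval ((l : ℚ) / M) : ℚ) : ℂ) := by
      have := Polynomial.aeval_algebraMap_apply ℂ ((l : ℚ) / M) (Polynomial.bernoulli n)
      simpa using this
    rw [map_smul, e3]
    have : (n.factorial : ℂ) ≠ 0 := by exact_mod_cast n.factorial_ne_zero
    rw [Rat.smul_def]
    push_cast
    field_simp
  rw [e2] at h
  have hC : (PowerSeries.C (M : ℂ)) ≠ 0 := by
    intro h0
    exact hM0 (by simpa using congrArg (PowerSeries.coeff 0) h0)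
  apply mul_left_cancel₀ hC
  rw [map_neg] at h
  linear_combination h * (1 : PowerSeries ℂ) 

lemma gen_sum (M : ℕ) (hM : 0 < M) (c : ℕ → ℂ) :
    (PowerSeries.X : PowerSeries ℂ) * ∑ l ∈ range M, PowerSeries.C (c l) * PowerSeries.rescale (-(l : ℂ)) (PowerSeries.exp ℂ) =
    (1 - PowerSeries.rescale (-(M : ℂ)) (PowerSeries.exp ℂ)) * PowerSeries.mk (tau M c) := by
  have : PowerSeries.mk (tau M c) = ∑ l ∈ range M, PowerSeries.C (c l) *
     PowerSeries.mk (fun n => (((Polynomial.bernoulli n).eval ((l : ℚ) / M) : ℚ) : ℂ) * (-M) ^ n / (M * n.factorial)) := by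
    ext n
    rw [PowerSeries.coeff_mk, map_sum]
    simp only [PowerSeries.coeff_C_mul, PowerSeries.coeff_mk, tau, bet, Finset.sum_mul, Finset.sum_div]
    refine Finset.sum_congr rfl fun l _ => ?_
    ring
  rw [this, Finset.mul_sum, Finset.mul_sum]
  refine Finset.sum_congr rfl fun l _ => ?_
  have := gen_id M hM l
  linear_combination PowerSeries.C (c l) * this

/-- near zero -/
lemma num_small (M : ℕ) (hM : 0 < M) (c : ℕ → ℂ) (m : ℕ) :
    (fun u => u * ∑ l ∈ range M, c l * cexp (-(l : ℂ) * u) -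
      (1 - cexp (-(M : ℂ) * u)) * ∑ i ∈ range m, tau M c i * u ^ i) =O[nhds 0] (fun u : ℂ => u ^ (m + 1)) := by
  set E : PowerSeries ℂ := 1 - PowerSeries.rescale (-(M : ℂ)) (PowerSeries.exp ℂ) with hE
  set T := PowerSeries.mk (tau M c) with hT
  have t1 : Tay (fun u => u * ∑ l ∈ range M, c l * cexp (-(l : ℂ) * u)) (E * T) := by
    rw [← gen_sum M hM c]
    exact Tay.id.mul (Tay.sum _ _ _ fun l _ => (Tay.const _).mul (Tay.exp _))
  have t2 : Tay (fun u => 1 - cexp (-(M : ℂ) * u)) E := by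
    have := (Tay.const 1).add ((Tay.const (-1)).mul (Tay.exp (-(M : ℂ))))
    rw [hE]
    convert this using 1
    · ext u; ring
    · simp [sub_eq_add_neg]
  have t3 : Tay (fun u => ∑ i ∈ range m, tau M c i * u ^ i) (PowerSeries.trunc m T : PowerSeries ℂ) := by
    convert Tay.poly (PowerSeries.trunc m T) using 2 with u
    rw [eval_tr]
    simp [hT]
  have t4 := t1.add ((Tay.const (-1)).mul (t2.mul t3))
  have hz : PowerSeries.trunc (m + 1) (E * T + PowerSeries.C (-1) * (E * (PowerSeries.trunc m T : PowerSeries ℂ))) = 0 := by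
    ext d
    rw [PowerSeries.coeff_trunc]
    split_ifs with hd
    · have : E * T + PowerSeries.C (-1) * (E * (PowerSeries.trunc m T : PowerSeries ℂ)) =
        E * (T - (PowerSeries.trunc m T : PowerSeries ℂ)) := by
        simp only [map_neg, map_one]; ring
      rw [this, PowerSeries.coeff_mul, Polynomial.coeff_zero]
      refine Finset.sum_eq_zero fun x hx => ?_
      rw [Finset.HasAntidiagonal.mem_antidiagonal] at hx
      by_cases h0 : x.1 = 0
      · rw [h0]
        have : PowerSeries.coeff 0 E = 0 := by
          rw [hE, map_sub, PowerSeries.coeff_rescale]; simp [PowerSeries.coeff_exp]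
        rw [this, zero_mul]
      · have : PowerSeries.coeff x.2 (T - (PowerSeries.trunc m T : PowerSeries ℂ)) = 0 := by
          rw [map_sub, Polynomial.coeff_coe, PowerSeries.coeff_trunc, if_pos (by omega), sub_self]
        rw [this, mul_zero]
    · simp
  have := t4 (m + 1)
  rw [hz] at this
  refine this.congr_left fun u => ?_
  simp; ring

lemma exp_lower (M : ℕ) (hM : 0 < M) :
    (fun u : ℂ => u) =O[nhds 0] (fun u : ℂ => 1 - cexp (-(M : ℂ) * u)) := by
  have hM0 : (M : ℂ) ≠ 0 := by exact_mod_cast hM.ne'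
  have hd : HasDerivAt (fun u : ℂ => 1 - cexp (-(M : ℂ) * u)) (M : ℂ) 0 := by
    have : HasDerivAt (fun u : ℂ => cexp (-(M : ℂ) * u)) (cexp (-(M : ℂ) * 0) * (-(M : ℂ) * 1)) 0 :=
      ((hasDerivAt_id (0 : ℂ)).const_mul (-(M : ℂ))).cexp
    refine (this.const_sub 1).congr_deriv ?_
    simp
  have := hd.isTheta_sub hM0
  simpa [Function.comp_def] using this.2

lemma Hk_near (M : ℕ) (hM : 0 < M) (c : ℕ → ℂ) (hc : Function.Periodic c M)
    (h : ∑ l ∈ range M, c l = 0) (m : ℕ) :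
    ∃ C : ℝ, ∃ δ : ℝ, 0 < δ ∧ 0 < C ∧ ∀ v : ℝ, v ≠ 0 → |v| < δ →
      ‖(2 * Real.pi * I * (ep * v)) * Hk M c (ep * v) -
        ∑ i ∈ range m, tau M c i * (2 * Real.pi * I * (ep * v)) ^ i‖ ≤ C * |v| ^ m := by
  obtain ⟨C1, hC1, h1⟩ := (num_small M hM c m).exists_pos
  obtain ⟨C2, hC2, h2⟩ := (exp_lower M hM).exists_pos
  have h3 := (h1.bound.and h2.bound)
  rw [Metric.eventually_nhds_iff] at h3
  obtain ⟨ε, hε, h3⟩ := h3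
  have hpi := Real.pi_pos
  refine ⟨C1 * C2 * (2 * Real.pi) ^ m, ε / (2 * Real.pi), by positivity, by positivity, fun v hv hvd => ?_⟩
  set u : ℂ := 2 * Real.pi * I * (ep * v) with hu
  have hun : ‖u‖ = 2 * Real.pi * |v| := by
    rw [hu]; simp [norm_ep, abs_of_pos hpi]
  have hupos : 0 < ‖u‖ := by rw [hun]; have := abs_pos.2 hv; positivity
  obtain ⟨b1, b2⟩ := @h3 u (by rw [dist_zero_right, hun]; rw [lt_div_iff₀ (by positivity)] at hvd; linarith)
  have hH := Hk_eq M hM c hc h v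
  have e1 : cexp (-(2 * Real.pi * I * M * (ep * v))) = cexp (-(M : ℂ) * u) := by
    congr 1; rw [hu]; ring
  have e2 : ∀ l : ℕ, cexp (-(2 * Real.pi * I * l * (ep * v))) = cexp (-(l : ℂ) * u) := by
    intro l; congr 1; rw [hu]; ring
  rw [e1] at hH
  simp_rw [e2] at hH
  rw [← hH] at b1
  have e3 : u * ((1 - cexp (-(M : ℂ) * u)) * Hk M c (ep * v)) -
      (1 - cexp (-(M : ℂ) * u)) * ∑ i ∈ range m, tau M c i * u ^ i =
      (1 - cexp (-(M : ℂ) * u)) * (u * Hk M c (ep * v) - ∑ i ∈ range m, tau M c i * u ^ i) := by ring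
  rw [e3, norm_mul, norm_pow] at b1
  set X := ‖u * Hk M c (ep * v) - ∑ i ∈ range m, tau M c i * u ^ i‖ with hX
  have hX0 : 0 ≤ X := norm_nonneg _
  have : ‖u‖ * X ≤ ‖u‖ * (C1 * C2 * (2 * Real.pi) ^ m * |v| ^ m) := by
    calc ‖u‖ * X ≤ (C2 * ‖1 - cexp (-(M : ℂ) * u)‖) * X := by gcongr
      _ = C2 * (‖1 - cexp (-(M : ℂ) * u)‖ * X) := by ring
      _ ≤ C2 * (C1 * ‖u‖ ^ (m + 1)) := by gcongr
      _ = ‖u‖ * (C1 * C2 * ‖u‖ ^ m) := by ring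
      _ = _ := by rw [hun, mul_pow]; ring
  exact le_of_mul_le_mul_left this hupos

lemma kern_bdd (θ : ℝ) (h0 : 0 < θ) (h1 : θ < 1) : ∃ B : ℝ, ∀ v : ℝ, ‖1 / den θ (ep * v)‖ ≤ B := by
  have hk := kern_gr θ h0 h1 0 (Or.inl rfl)
  simp only [ofReal_zero, zero_mul, add_zero] at hk
  obtain ⟨B, hB⟩ := (isCompact_Icc (a := (-2 : ℝ)) (b := 2)).exists_bound_of_continuousOn hk.1.continuousOn
  refine ⟨max B 2, fun v => ?_⟩
  by_cases hv : |v| ≤ 2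
  · exact (hB v (abs_le.1 hv)).trans (le_max_left _ _)
  · have := den_far' θ v (by simp) (by simpa using hR_pos.le) (by simpa using (not_le.1 hv).le)
    refine le_trans ?_ (le_max_right _ _)
    rw [norm_div, norm_one, div_le_iff₀ (by linarith)]
    linarith

lemma Hk_bdd (M : ℕ) (c : ℕ → ℂ) : ∃ B : ℝ, 0 ≤ B ∧ ∀ v : ℝ, ‖Hk M c (ep * v)‖ ≤ B := by
  have : ∀ j : ℕ, ∃ B : ℝ, j ∈ Ico 1 M → ∀ v : ℝ, ‖1 / den ((j : ℝ) / M) (ep * v)‖ ≤ B := by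
    intro j
    by_cases hj : j ∈ Ico 1 M
    · obtain ⟨h0, h1⟩ := theta_mem M j hj
      obtain ⟨B, hB⟩ := kern_bdd _ h0 h1
      exact ⟨B, fun _ => hB⟩
    · exact ⟨0, fun h => absurd h hj⟩
  choose B hB using this
  have hb : ∀ v : ℝ, ‖Hk M c (ep * v)‖ ≤ ∑ j ∈ Ico 1 M, ‖rF M c j‖ * B j := by
    intro v
    unfold Hk
    refine (norm_sum_le _ _).trans (Finset.sum_le_sum fun j hj => ?_)
    rw [norm_mul]
    exact mul_le_mul_of_nonneg_left (hB j hj v) (norm_nonneg _)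
  exact ⟨_, (norm_nonneg _).trans (hb 0), hb⟩

lemma Hk_global (M : ℕ) (hM : 0 < M) (c : ℕ → ℂ) (hc : Function.Periodic c M)
    (h : ∑ l ∈ range M, c l = 0) (m : ℕ) (hm : 1 ≤ m) :
    ∃ C : ℝ, 0 ≤ C ∧ ∀ v : ℝ, v ≠ 0 →
      ‖(2 * Real.pi * I * (ep * v)) * Hk M c (ep * v) -
        ∑ i ∈ range m, tau M c i * (2 * Real.pi * I * (ep * v)) ^ i‖ ≤ C * |v| ^ m := by
  obtain ⟨C, δ, hδ, hC, h1⟩ := Hk_near M hM c hc h m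
  obtain ⟨B, hB0, hB⟩ := Hk_bdd M c
  have hpi := Real.pi_pos
  have hun : ∀ v : ℝ, ‖(2 * Real.pi * I * (ep * v) : ℂ)‖ = 2 * Real.pi * |v| := by
    intro v; simp [norm_ep, abs_of_pos hpi]
  set D : ℝ := 2 * Real.pi * B * δ * (δ⁻¹) ^ m + ∑ i ∈ range m, ‖tau M c i‖ * (2 * Real.pi * δ) ^ i * (δ⁻¹) ^ m with hD
  have hD0 : 0 ≤ D := by rw [hD]; positivity
  refine ⟨C + D, by positivity, fun v hv => ?_⟩
  by_cases hvd : |v| < δ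
  · refine (h1 v hv hvd).trans ?_
    gcongr; linarith
  · push Not at hvd
    set x := |v| / δ with hx
    have hx1 : 1 ≤ x := by rw [hx, one_le_div hδ]; exact hvd
    have hv' : |v| = δ * x := by rw [hx]; field_simp
    have hpow : ∀ i ≤ m, |v| ^ i ≤ δ ^ i * (δ⁻¹) ^ m * |v| ^ m := by
      intro i hi
      rw [hv', mul_pow, mul_pow]
      calc δ ^ i * x ^ i ≤ δ ^ i * x ^ m := by gcongr
        _ = δ ^ i * (δ⁻¹ * δ) ^ m * x ^ m := by rw [inv_mul_cancel₀ hδ.ne', one_pow, mul_one]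
        _ = _ := by rw [mul_pow]; ring
    calc _ ≤ ‖(2 * Real.pi * I * (ep * v)) * Hk M c (ep * v)‖ +
        ‖∑ i ∈ range m, tau M c i * (2 * Real.pi * I * (ep * v)) ^ i‖ := norm_sub_le _ _
      _ ≤ 2 * Real.pi * |v| ^ 1 * B + ∑ i ∈ range m, ‖tau M c i‖ * ((2 * Real.pi) ^ i * |v| ^ i) := by
        gcongr
        · rw [norm_mul, hun, pow_one]
          gcongr
          exact hB v
        · refine (norm_sum_le _ _).trans (Finset.sum_le_sum fun i _ => ?_)
          rw [norm_mul, norm_pow, hun, mul_pow]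
      _ ≤ 2 * Real.pi * (δ ^ 1 * (δ⁻¹) ^ m * |v| ^ m) * B + ∑ i ∈ range m, ‖tau M c i‖ * ((2 * Real.pi) ^ i * (δ ^ i * (δ⁻¹) ^ m * |v| ^ m)) := by
        gcongr with i hi
        · exact hpow 1 hm
        · exact hpow i (Finset.mem_range.1 hi).le
      _ = D * |v| ^ m := by
        rw [hD, add_mul, Finset.sum_mul]
        congr 1
        · ring
        · refine Finset.sum_congr rfl fun i _ => ?_
          rw [mul_pow]; ring
      _ ≤ _ := by gcongr; linarith


lemma mom_odd {b : ℝ} (hb : 0 < b) (k : ℕ) : Jn b 0 (2 * k + 1) = 0 := by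
  have hb' : (b : ℂ) ≠ 0 := by exact_mod_cast hb.ne'
  induction k with
  | zero =>
    have := Jn_rec hb 0 0
    simpa [hb'] using this
  | succ k ih =>
    have := Jn_rec hb 0 (2 * k + 2)
    rw [show 2 * k + 2 - 1 = 2 * k + 1 by omega, ih] at this
    simpa [hb', show 2 * (k + 1) + 1 = 2 * k + 2 + 1 by ring] using this

lemma mom_even {b : ℝ} (hb : 0 < b) (k : ℕ) :
    Jn b 0 (2 * k) = ((2 * k).factorial : ℂ) / (k.factorial * (4 * b) ^ k) * Jn b 0 0 := by
  have hb' : (b : ℂ) ≠ 0 := by exact_mod_cast hb.ne'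
  induction k with
  | zero => simp
  | succ k ih =>
    have := Jn_rec hb 0 (2 * k + 1)
    rw [show 2 * k + 1 - 1 = 2 * k by omega, ih] at this
    rw [show 2 * (k + 1) = 2 * k + 1 + 1 by ring]
    have h2 : Jn b 0 (2 * k + 1 + 1) = (2 * k + 1 : ℕ) / (2 * b) * (((2 * k).factorial : ℂ) / (k.factorial * (4 * b) ^ k) * Jn b 0 0) := by
      field_simp
      field_simp at this
      linear_combination -this
    rw [h2, Nat.factorial_succ (2 * k + 1), Nat.factorial_succ (2 * k), Nat.factorial_succ k]
    have h3 : (k.factorial : ℂ) ≠ 0 := by exact_mod_cast k.factorial_ne_zero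
    have h4 : (k : ℂ) + 1 ≠ 0 := by exact_mod_cast k.succ_ne_zero
    push_cast
    field_simp
    ring

lemma Jn00 {W : ℝ} (hW : 0 < W) : (Real.sqrt W : ℂ) * Jn (Real.pi * W) 0 0 = 1 := by
  have := Jn_zero hW 0
  simpa using this

lemma sum_even_odd (g : ℕ → ℂ) (n : ℕ) :
    ∑ i ∈ range (2 * n), g i = ∑ k ∈ range n, (g (2 * k) + g (2 * k + 1)) := by
  induction n with
  | zero => simp
  | succ n ih => rw [show 2 * (n + 1) = 2 * n + 1 + 1 by ring, Finset.sum_range_succ,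
      Finset.sum_range_succ, Finset.sum_range_succ, ih]; ring

lemma tau_zero (M : ℕ) (c : ℕ → ℂ) (h : ∑ l ∈ range M, c l = 0) : tau M c 0 = 0 := by
  simp [tau, bet, h]

lemma asym (M : ℕ) (hM : 0 < M) (c : ℕ → ℂ) (hc : Function.Periodic c M)
    (h : ∑ l ∈ range M, c l = 0) (K : ℕ) :
    ∃ C : ℝ, ∀ N : ℕ, 0 < N → ∀ W : ℕ, W = M * N →
      ‖(W : ℂ) / 4 * ((Real.sqrt W : ℂ) * (2 * (∫ v : ℝ, (ep * v) * Hk M c (ep * v) *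
        cexp (-(Real.pi * W : ℝ) * (v : ℂ) ^ 2)))) -
        ∑ k ∈ range (K + 1), (1 / 4 : ℂ) * M ^ (2 * k + 1) * bet M c (2 * k + 2) / (k + 1).factorial *
          (Real.pi * I / W) ^ k‖ ≤ C / (N : ℝ) ^ (K + 1) := by
  obtain ⟨C, hC0, hC⟩ := Hk_global M hM c hc h (2 * (K + 2)) (by omega)
  have hpi := Real.pi_pos
  have hpc : (Real.pi : ℂ) ≠ 0 := by exact_mod_cast hpi.ne'
  refine ⟨1 / (4 * Real.pi) * (C * ((2 * (K + 2)).factorial / ((K + 2).factorial * (4 * Real.pi) ^ (K + 2)))), fun N hN W hW => ?_⟩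
  have hWpos : 0 < W := by rw [hW]; positivity
  have hWr : (0 : ℝ) < W := by exact_mod_cast hWpos
  have hWc : (W : ℂ) ≠ 0 := by exact_mod_cast hWpos.ne'
  have hMc : (M : ℂ) ≠ 0 := by exact_mod_cast hM.ne'
  have hb : 0 < Real.pi * W := mul_pos hpi hWr
  set b := Real.pi * W with hbdef
  have hJ0 := Jn00 hWr
  rw [← hbdef] at hJ0
  set A := ∫ v : ℝ, (ep * v) * Hk M c (ep * v) * cexp (-(b : ℂ) * (v : ℂ) ^ 2) with hA
  -- integrability
  have hHgr : Gr (fun v : ℝ => Hk M c (ep * v)) := by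
    obtain ⟨B, hB0, hB⟩ := Hk_bdd M c
    refine ⟨?_, B, 0, hB0, le_refl _, fun v => by simpa using hB v⟩
    unfold Hk
    refine continuous_finsetSum _ fun j hj => ?_
    obtain ⟨h0, h1⟩ := theta_mem M j hj
    have hk := kern_gr _ h0 h1 0 (Or.inl rfl)
    simp only [ofReal_zero, zero_mul, add_zero] at hk
    exact continuous_const.mul hk.1
  have iF : MeasureTheory.Integrable (fun v : ℝ => (2 * Real.pi * I * (ep * v)) * Hk M c (ep * v) *
      cexp (-(b : ℂ) * (v : ℂ) ^ 2)) :=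
    ((((Gr.const (2 * Real.pi * I)).mul ((Gr.const ep).mul Gr.id)).mul hHgr)).integrable hb
  have iT : ∀ i ∈ range (2 * (K + 2)), MeasureTheory.Integrable (fun v : ℝ => tau M c i * (2 * Real.pi * I * ep) ^ i *
      ((v : ℂ) ^ i * cexp (0 * v) * cexp (-(b : ℂ) * (v : ℂ) ^ 2))) :=
    fun i _ => (Jn_int hb 0 i).const_mul _
  have iS := MeasureTheory.integrable_finsetSum (range (2 * (K + 2))) iT
  set R := ∫ v : ℝ, ((2 * Real.pi * I * (ep * v)) * Hk M c (ep * v) -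
        ∑ i ∈ range (2 * (K + 2)), tau M c i * (2 * Real.pi * I * (ep * v)) ^ i) *
      cexp (-(b : ℂ) * (v : ℂ) ^ 2) with hR
  have hsplit : R = 2 * Real.pi * I * A - ∑ i ∈ range (2 * (K + 2)), tau M c i * (2 * Real.pi * I * ep) ^ i * Jn b 0 i := by
    have e1 : ∀ v : ℝ, ((2 * Real.pi * I * (ep * v)) * Hk M c (ep * v) -
        ∑ i ∈ range (2 * (K + 2)), tau M c i * (2 * Real.pi * I * (ep * v)) ^ i) *
      cexp (-(b : ℂ) * (v : ℂ) ^ 2) = (2 * Real.pi * I * (ep * v)) * Hk M c (ep * v) *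
      cexp (-(b : ℂ) * (v : ℂ) ^ 2) - ∑ i ∈ range (2 * (K + 2)), tau M c i * (2 * Real.pi * I * ep) ^ i *
      ((v : ℂ) ^ i * cexp (0 * v) * cexp (-(b : ℂ) * (v : ℂ) ^ 2)) := by
      intro v
      rw [sub_mul, Finset.sum_mul]
      congr 1
      refine Finset.sum_congr rfl fun i _ => ?_
      rw [zero_mul, Complex.exp_zero, ← mul_assoc, mul_pow]; ring
    rw [hR]
    simp_rw [e1]
    rw [MeasureTheory.integral_sub iF iS, MeasureTheory.integral_finsetSum _ iT]
    simp_rw [MeasureTheory.integral_const_mul]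
    congr 1
    rw [hA, ← MeasureTheory.integral_const_mul]
    refine MeasureTheory.integral_congr_ae (Filter.Eventually.of_forall fun v => ?_)
    simp only; ring
  have hRb : ‖R‖ ≤ C * ‖Jn b 0 (2 * (K + 2))‖ := by
    have e2 : Jn b 0 (2 * (K + 2)) = ((∫ v : ℝ, |v| ^ (2 * (K + 2)) * Real.exp (-b * v ^ 2) : ℝ) : ℂ) := by
      unfold Jn
      rw [← integral_complex_ofReal]
      refine MeasureTheory.integral_congr_ae (Filter.Eventually.of_forall fun v => ?_)
      simp only [zero_mul, Complex.exp_zero, mul_one]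
      rw [pow_mul |v|, sq_abs, ← pow_mul]
      push_cast
      rfl
    have i3 : MeasureTheory.Integrable (fun v : ℝ => |v| ^ (2 * (K + 2)) * Real.exp (-b * v ^ 2)) := by
      have := (Jn_int hb 0 (2 * (K + 2))).norm
      refine this.congr (Filter.Eventually.of_forall fun v => ?_)
      simp only [zero_mul, Complex.exp_zero, mul_one, norm_mul, norm_pow]
      rw [Complex.norm_exp]
      simp [← ofReal_pow]
    have e3 : ‖Jn b 0 (2 * (K + 2))‖ = ∫ v : ℝ, |v| ^ (2 * (K + 2)) * Real.exp (-b * v ^ 2) := by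
      rw [e2, Complex.norm_real, Real.norm_eq_abs, abs_of_nonneg]
      exact MeasureTheory.integral_nonneg fun v => by positivity
    rw [e3, ← MeasureTheory.integral_const_mul]
    refine MeasureTheory.norm_integral_le_of_norm_le (i3.const_mul C) ?_
    have hae : ∀ᵐ v : ℝ, v ≠ 0 := MeasureTheory.Measure.ae_ne _ 0
    filter_upwards [hae] with v hv
    rw [norm_mul, Complex.norm_exp]
    have : (-(b : ℂ) * (v : ℂ) ^ 2).re = -b * v ^ 2 := by
      simp [← ofReal_pow]
    rw [this]
    calc _ ≤ (C * |v| ^ (2 * (K + 2))) * Real.exp (-b * v ^ 2) :=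
          mul_le_mul_of_nonneg_right (hC v hv) (Real.exp_pos _).le
      _ = _ := by ring
  have hmain : (W : ℂ) / 4 * ((Real.sqrt W : ℂ) * (2 * A)) -
        ∑ k ∈ range (K + 1), (1 / 4 : ℂ) * M ^ (2 * k + 1) * bet M c (2 * k + 2) / (k + 1).factorial *
          (Real.pi * I / W) ^ k = W * Real.sqrt W / (4 * Real.pi * I) * R := by
    rw [hsplit, sum_even_odd]
    rw [Finset.sum_range_succ' _ (K + 1)]
    rw [mul_zero, tau_zero M c h]
    simp only [zero_add, mom_odd hb, mul_zero, add_zero, zero_mul]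
    have hodd1 : Jn b 0 1 = 0 := mom_odd hb 0
    rw [hodd1, mul_zero, add_zero, mul_sub, Finset.mul_sum]
    have hI := I_ne_zero
    congr 1
    · field_simp
    · refine Finset.sum_congr rfl fun k _ => ?_
      rw [mom_even hb (k + 1)]
      have e5 : (2 * Real.pi * I * ep) ^ (2 * (k + 1)) = (4 * Real.pi ^ 2 * I) ^ (k + 1) := by
        rw [pow_mul]
        congr 1
        rw [mul_pow, ep_sq]
        linear_combination (-4 * Real.pi ^ 2 * I : ℂ) * I_sq
      rw [e5]
      have e6 : (4 * (b : ℂ)) ^ (k + 1) = (4 * Real.pi * W) ^ (k + 1) := by rw [hbdef]; push_cast; ring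
      rw [e6]
      unfold tau
      have f1 : ((2 * (k + 1)).factorial : ℂ) ≠ 0 := by exact_mod_cast Nat.factorial_ne_zero _
      have f2 : ((k + 1).factorial : ℂ) ≠ 0 := by exact_mod_cast Nat.factorial_ne_zero _
      have e7 : (-(M : ℂ)) ^ (2 * (k + 1)) = M ^ (2 * k + 1) * M := by
        rw [Even.neg_pow (by simp)]; ring
      rw [e7, show 2 * (k + 1) = 2 * k + 2 by ring]
      rw [show 2 * (k + 1) = 2 * k + 2 by ring] at f1
      calc _ = (1 / 4 : ℂ) * M ^ (2 * k + 1) * bet M c (2 * k + 2) / (k + 1).factorial *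
          (Real.pi * I / W) ^ k * (Real.sqrt W * Jn b 0 0) := by rw [hJ0, mul_one]
        _ = _ := by
          have e8 : (4 * Real.pi ^ 2 * I : ℂ) ^ (k + 1) / (4 * Real.pi * W) ^ (k + 1) = (Real.pi * I / W) ^ k * (Real.pi * I / W) := by
            rw [← div_pow, ← pow_succ]; congr 1; field_simp
          calc _ = W * Real.sqrt W / (4 * Real.pi * I) * (bet M c (2 * k + 2) * (M ^ (2 * k + 1)) / (k + 1).factorial * ((Real.pi * I / W) ^ k * (Real.pi * I / W)) * Jn b 0 0) := by
                field_simp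
            _ = _ := by
                rw [← e8]
                field_simp
  rw [hmain, norm_mul]
  have hnJ : ‖Jn b 0 (2 * (K + 2))‖ = ((2 * (K + 2)).factorial : ℝ) / ((K + 2).factorial * (4 * Real.pi) ^ (K + 2)) / (W : ℝ) ^ (K + 2) / Real.sqrt W := by
    have hs : (Real.sqrt W : ℝ) ≠ 0 := (Real.sqrt_pos.2 hWr).ne'
    have hn0 : ‖Jn b 0 0‖ = 1 / Real.sqrt W := by
      have := congrArg norm hJ0
      rw [norm_mul, norm_one, Complex.norm_real, Real.norm_eq_abs, abs_of_nonneg (Real.sqrt_nonneg _)] at this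
      field_simp; linarith
    rw [mom_even hb, norm_mul, hn0, norm_div, norm_mul, norm_pow, norm_mul]
    simp only [Complex.norm_natCast, Complex.norm_ofNat, Complex.norm_real, Real.norm_eq_abs, abs_of_pos hb]
    rw [hbdef, ← mul_assoc, mul_pow _ (W : ℝ)]
    field_simp
  have hcoef : ‖(W * Real.sqrt W / (4 * Real.pi * I) : ℂ)‖ = W * Real.sqrt W / (4 * Real.pi) := by
    simp [abs_of_pos hpi, abs_of_nonneg (Real.sqrt_nonneg _)]
  rw [hcoef]
  have hNr : (0 : ℝ) < N := by exact_mod_cast hN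
  have hNW : (N : ℝ) ≤ W := by exact_mod_cast (by rw [hW]; exact Nat.le_mul_of_pos_left N hM)
  set D := ((2 * (K + 2)).factorial : ℝ) / ((K + 2).factorial * (4 * Real.pi) ^ (K + 2)) with hD
  have hs : (0 : ℝ) < Real.sqrt W := Real.sqrt_pos.2 hWr
  calc W * Real.sqrt W / (4 * Real.pi) * ‖R‖ ≤ W * Real.sqrt W / (4 * Real.pi) * (C * (D / (W : ℝ) ^ (K + 2) / Real.sqrt W)) := by
        rw [hnJ] at hRb; gcongr
    _ = 1 / (4 * Real.pi) * (C * D) / (W : ℝ) ^ (K + 1) := by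
        field_simp
        ring
    _ ≤ _ := by gcongr


noncomputable def Pset (s t : ℤ) : Finset (ℤ × ℤ) :=
  (Finset.Icc (1 : ℤ) (s - 1) ×ˢ Finset.Icc (1 : ℤ) (t - 1)).filter
                (fun x => 0 < x.1 * t - x.2 * s)

lemma mem_Pset {s t : ℤ} {x : ℤ × ℤ} : x ∈ Pset s t ↔
    (0 < x.1 ∧ x.1 < s ∧ 0 < x.2 ∧ x.2 < t) ∧ x.2 * s < x.1 * t := by
  unfold Pset
  rw [Finset.mem_filter, Finset.mem_product, Finset.mem_Icc, Finset.mem_Icc]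
  constructor
  · rintro ⟨⟨⟨h1, h2⟩, h3, h4⟩, h5⟩
    exact ⟨⟨by omega, by omega, by omega, by omega⟩, by linarith⟩
  · rintro ⟨⟨h1, h2, h3, h4⟩, h5⟩
    exact ⟨⟨⟨by omega, by omega⟩, by omega, by omega⟩, by linarith⟩

lemma sgn_case {s a b σ σ' : ℤ} (ha : 0 < a) (has : a < s) (hb : 0 < b) (hbs : b < s)
    (h1 : σ = 1 ∨ σ = -1) (h2 : σ' = 1 ∨ σ' = -1) (hd : s ∣ σ * a - σ' * b) :
    (σ = σ' ∧ a = b) ∨ (σ' = -σ ∧ a + b = s) := by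
  have h0 : ∀ x : ℤ, s ∣ x → -s < x → x < s → x = 0 := by
    intro x hx h1 h2
    exact Int.eq_zero_of_abs_lt_dvd hx (by rw [abs_lt]; exact ⟨h1, h2⟩)
  rcases h1 with rfl | rfl <;> rcases h2 with rfl | rfl
  · left; refine ⟨rfl, ?_⟩
    have := h0 _ hd (by linarith) (by linarith); linarith
  · right; refine ⟨rfl, ?_⟩
    have := h0 (a + b - s) (by
      have : s ∣ (1 * a - -1 * b) - s := dvd_sub hd dvd_rfl
      simpa using this) (by linarith) (by linarith); linarith
  · right; refine ⟨by norm_num, ?_⟩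
    have := h0 (a + b - s) (by
      have : s ∣ -(-1 * a - 1 * b) - s := dvd_sub (hd.neg_right) dvd_rfl
      ring_nf at this ⊢
      exact this) (by linarith) (by linarith); linarith
  · left; refine ⟨rfl, ?_⟩
    have := h0 _ hd (by linarith) (by linarith); linarith

lemma inj_aux {s t : ℤ} (hs : 0 < s) (ht : 0 < t) (hst : IsCoprime s t) {x y : ℤ × ℤ}
    (hx : x ∈ Pset s t) (hy : y ∈ Pset s t) {σ τ σ' τ' : ℤ}
    (h1 : σ = 1 ∨ σ = -1) (h2 : τ = 1 ∨ τ = -1) (h3 : σ' = 1 ∨ σ' = -1) (h4 : τ' = 1 ∨ τ' = -1)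
    (hd : 2 * s * t ∣ (σ * x.1 * t + τ * x.2 * s) - (σ' * y.1 * t + τ' * y.2 * s)) :
    x = y ∧ σ = σ' ∧ τ = τ' := by
  obtain ⟨⟨x1, x2, x3, x4⟩, x5⟩ := mem_Pset.1 hx
  obtain ⟨⟨y1, y2, y3, y4⟩, y5⟩ := mem_Pset.1 hy
  obtain ⟨q, hq⟩ := hd
  have d1 : s ∣ σ * x.1 - σ' * y.1 := by
    refine hst.dvd_of_dvd_mul_right (?_ : s ∣ _ * t)
    exact ⟨2 * t * q - τ * x.2 + τ' * y.2, by linear_combination hq⟩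
  have d2 : t ∣ τ * x.2 - τ' * y.2 := by
    refine hst.symm.dvd_of_dvd_mul_right (?_ : t ∣ _ * s)
    exact ⟨2 * s * q - σ * x.1 + σ' * y.1, by linear_combination hq⟩
  have hst0 : s * t ≠ 0 := (mul_pos hs ht).ne'
  rcases sgn_case x1 x2 y1 y2 h1 h3 d1 with ⟨e1, e2⟩ | ⟨e1, e2⟩ <;>
  rcases sgn_case x3 x4 y3 y4 h2 h4 d2 with ⟨e3, e4⟩ | ⟨e3, e4⟩
  · exact ⟨Prod.ext e2 e4, e1, e3⟩
  · exfalso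
    have : τ * (s * t) = 2 * q * (s * t) := by
      rw [← e1, e3, ← e2] at hq
      linear_combination hq - τ * s * e4
    have := mul_right_cancel₀ hst0 this
    omega
  · exfalso
    have : σ * (s * t) = 2 * q * (s * t) := by
      rw [← e3, e1, ← e4] at hq
      linear_combination hq - σ * t * e2
    have := mul_right_cancel₀ hst0 this
    omega
  · exfalso
    have : x.1 * t + y.1 * t - (x.2 * s + y.2 * s) = 0 := by linear_combination t * e2 - s * e4
    linarith

def fmap (s t : ℤ) (y : (ℤ × ℤ) × (ℤ × ℤ)) : ℤ :=
  (y.2.1 * y.1.1 * t + y.2.2 * y.1.2 * s) + (1 - y.2.1) * (s * t)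

lemma regroup (s t : ℤ) (hs : 0 < s) (ht : 0 < t) (hst : IsCoprime s t) (g : ℤ → ℂ)
    (hg : ∀ j, s ∣ j ∨ t ∣ j → g j = 0) :
    ∑ j ∈ Ioo 0 (2 * s * t), g j = ∑ x ∈ Pset s t,
      (g (x.1 * t - x.2 * s) + g (2 * s * t - (x.1 * t - x.2 * s)) +
        g (x.1 * t + x.2 * s) + g (2 * s * t - (x.1 * t + x.2 * s))) := by
  have hst0 : 0 < s * t := mul_pos hs ht
  have e1 : ∑ j ∈ Ioo 0 (2 * s * t), g j = ∑ j ∈ (Ioo 0 (2 * s * t)).filter (fun j => ¬ (s ∣ j ∨ t ∣ j)), g j := by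
    symm
    refine Finset.sum_subset (Finset.filter_subset _ _) fun j hj hj2 => ?_
    rw [Finset.mem_filter, not_and, not_not] at hj2
    exact hg j (hj2 hj)
  have e2 : ∑ x ∈ Pset s t,
      (g (x.1 * t - x.2 * s) + g (2 * s * t - (x.1 * t - x.2 * s)) +
        g (x.1 * t + x.2 * s) + g (2 * s * t - (x.1 * t + x.2 * s))) =
      ∑ y ∈ Pset s t ×ˢ (({1, -1} : Finset ℤ) ×ˢ ({1, -1} : Finset ℤ)), g (fmap s t y) := by
    rw [Finset.sum_product]
    refine Finset.sum_congr rfl fun x _ => ?_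
    rw [Finset.sum_product]
    rw [Finset.sum_pair (by norm_num), Finset.sum_pair (by norm_num), Finset.sum_pair (by norm_num)]
    simp only [fmap]
    ring_nf
  rw [e1, e2]
  symm
  have hsg : ∀ σ : ℤ, σ ∈ ({1, -1} : Finset ℤ) ↔ σ = 1 ∨ σ = -1 := by intro σ; simp
  refine Finset.sum_nbij (fmap s t) ?_ ?_ ?_ (fun _ _ => rfl)
  · rintro ⟨x, σ, τ⟩ hy
    rw [Finset.mem_product, Finset.mem_product, hsg, hsg] at hy
    obtain ⟨hx, h1, h2⟩ := hy
    obtain ⟨⟨x1, x2, x3, x4⟩, x5⟩ := mem_Pset.1 hx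
    simp only at h1 h2 x1 x2 x3 x4 x5 hx
    have p1 : 0 < x.1 * t := mul_pos x1 ht
    have p2 : 0 < x.2 * s := mul_pos x3 hs
    have p3 : x.1 * t < s * t := by gcongr
    have p4 : x.2 * s < t * s := by gcongr
    rw [Finset.mem_filter, Finset.mem_Ioo]
    refine ⟨?_, ?_⟩
    · rcases h1 with rfl | rfl <;> rcases h2 with rfl | rfl <;> simp only [fmap] <;>
        constructor <;> nlinarith
    · have hσ : IsUnit σ := by rcases h1 with rfl | rfl <;> simp
      have hτ : IsUnit τ := by rcases h2 with rfl | rfl <;> simp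
      rintro (⟨q, hq⟩ | ⟨q, hq⟩) <;> simp only [fmap] at hq
      · have d1 : s ∣ σ * x.1 := by
          refine hst.dvd_of_dvd_mul_right (?_ : s ∣ _ * t)
          exact ⟨q - τ * x.2 - (1 - σ) * t, by linear_combination hq⟩
        rw [hσ.dvd_mul_left] at d1
        exact absurd (Int.le_of_dvd x1 d1) (by omega)
      · have d1 : t ∣ τ * x.2 := by
          refine hst.symm.dvd_of_dvd_mul_right (?_ : t ∣ _ * s)
          exact ⟨q - σ * x.1 - (1 - σ) * s, by linear_combination hq⟩
        rw [hτ.dvd_mul_left] at d1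
        exact absurd (Int.le_of_dvd x3 d1) (by omega)
  · rintro ⟨x, σ, τ⟩ hy ⟨x', σ', τ'⟩ hy' he
    rw [Finset.mem_coe, Finset.mem_product, Finset.mem_product, hsg, hsg] at hy hy'
    obtain ⟨hx, h1, h2⟩ := hy
    obtain ⟨hx', h3, h4⟩ := hy'
    simp only at h1 h2 h3 h4 hx hx'
    have hd : 2 * s * t ∣ (σ * x.1 * t + τ * x.2 * s) - (σ' * x'.1 * t + τ' * x'.2 * s) := by
      have hpar : ∃ q, σ - σ' = 2 * q := by
        rcases h1 with rfl | rfl <;> rcases h3 with rfl | rfl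
        · exact ⟨0, by norm_num⟩
        · exact ⟨1, by norm_num⟩
        · exact ⟨-1, by norm_num⟩
        · exact ⟨0, by norm_num⟩
      obtain ⟨q, hq⟩ := hpar
      simp only [fmap] at he
      exact ⟨q, by linear_combination he + s * t * hq⟩
    obtain ⟨r1, r2, r3⟩ := inj_aux hs ht hst hx hx' h1 h2 h3 h4 hd
    rw [r1, r2, r3]
  · intro j hj
    rw [Finset.mem_coe, Finset.mem_filter, Finset.mem_Ioo, not_or] at hj
    obtain ⟨⟨j0, j1⟩, js, jt⟩ := hj
    have hst' := hst
    obtain ⟨u, v, huv⟩ := hst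
    set n0 := (j * v) % s with hn0
    set m0 := (j * u) % t with hm0
    have dn := Int.emod_add_mul_ediv (j * v) s
    have dm := Int.emod_add_mul_ediv (j * u) t
    rw [← hn0] at dn
    rw [← hm0] at dm
    have n1 := Int.emod_nonneg (j * v) hs.ne'
    have n2 := Int.emod_lt_of_pos (j * v) hs
    have m1 := Int.emod_nonneg (j * u) ht.ne'
    have m2 := Int.emod_lt_of_pos (j * u) ht
    rw [← hn0] at n1 n2
    rw [← hm0] at m1 m2
    set Q := j * v / s + j * u / t with hQ
    have hj : j = n0 * t + m0 * s + Q * (s * t) := by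
      rw [hQ]; linear_combination (-t) * dn - s * dm - j * huv
    have n3 : n0 ≠ 0 := by
      intro h0; apply js; rw [hj, h0]; exact ⟨m0 + Q * t, by ring⟩
    have m3 : m0 ≠ 0 := by
      intro h0; apply jt; rw [hj, h0]; exact ⟨n0 + Q * s, by ring⟩
    have n4 : 0 < n0 := by omega
    have m4 : 0 < m0 := by omega
    have p1 : 0 < n0 * t := mul_pos n4 ht
    have p2 : 0 < m0 * s := mul_pos m4 hs
    have p3 : n0 * t < s * t := by gcongr
    have p4 : m0 * s < t * s := by gcongr
    have q1 : -2 < Q := by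
      by_contra hq
      push Not at hq
      nlinarith
    have q2 : Q < 2 := by
      by_contra hq
      push Not at hq
      nlinarith
    clear_value Q n0 m0
    have hmem : ∀ (x : ℤ × ℤ) (σ τ : ℤ), x ∈ Pset s t → (σ = 1 ∨ σ = -1) → (τ = 1 ∨ τ = -1) →
        fmap s t (x, σ, τ) = j → j ∈ fmap s t '' ((Pset s t ×ˢ (({1, -1} : Finset ℤ) ×ˢ ({1, -1} : Finset ℤ)) : Finset _) : Set ((ℤ × ℤ) × (ℤ × ℤ))) := by
      intro x σ τ hx h1 h2 he
      refine ⟨(x, σ, τ), ?_, he⟩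
      rw [Finset.mem_coe, Finset.mem_product, Finset.mem_product, hsg, hsg]
      exact ⟨hx, h1, h2⟩
    have hQc : Q = -1 ∨ Q = 0 ∨ Q = 1 := by omega
    rcases hQc with rfl | rfl | rfl
    · refine hmem (n0, t - m0) 1 (-1) ?_ (Or.inl rfl) (Or.inr rfl) ?_
      · rw [mem_Pset]; simp only; exact ⟨⟨by omega, by omega, by omega, by omega⟩, by linarith⟩
      · simp only [fmap]; rw [hj]; ring
    · rcases lt_trichotomy (n0 * t) (m0 * s) with hlt | heq | hgt
      · refine hmem (s - n0, t - m0) (-1) (-1) ?_ (Or.inr rfl) (Or.inr rfl) ?_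
        · rw [mem_Pset]; simp only; exact ⟨⟨by omega, by omega, by omega, by omega⟩, by linarith⟩
        · simp only [fmap]; rw [hj]; ring
      · exfalso
        apply js
        have : s ∣ n0 := hst'.dvd_of_dvd_mul_right (⟨m0, by rw [heq]; ring⟩ : s ∣ n0 * t)
        exact absurd (Int.le_of_dvd n4 this) (by omega)
      · refine hmem (n0, m0) 1 1 ?_ (Or.inl rfl) (Or.inl rfl) ?_
        · rw [mem_Pset]; simp only; exact ⟨⟨by omega, by omega, by omega, by omega⟩, by linarith⟩
        · simp only [fmap]; rw [hj]; ring
    · refine hmem (s - n0, m0) (-1) 1 ?_ (Or.inr rfl) (Or.inl rfl) ?_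
      · rw [mem_Pset]; simp only; exact ⟨⟨by omega, by omega, by omega, by omega⟩, by linarith⟩
      · simp only [fmap]; rw [hj]; ring


section arith
variable {s t n m : ℤ}

lemma ind_eq (hs : 0 < s) (ht : 0 < t) (hst : IsCoprime s t)
    (hn : 0 < n) (hns : n < s) (hm : 0 < m) (hmt : m < t) (k : ℤ) :
    (chi s t n m k : ℂ) = (if k ≡ n * t - m * s [ZMOD 2 * s * t] then 1 else 0) +
      (if k ≡ -(n * t - m * s) [ZMOD 2 * s * t] then 1 else 0) -
      (if k ≡ n * t + m * s [ZMOD 2 * s * t] then 1 else 0) -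
      (if k ≡ -(n * t + m * s) [ZMOD 2 * s * t] then 1 else 0) := by
  have hsn : ¬ s ∣ n := fun h => absurd (Int.le_of_dvd hn h) (by omega)
  have htm : ¬ t ∣ m := fun h => absurd (Int.le_of_dvd hm h) (by omega)
  have hsn' : ¬ s ∣ n * t := fun h => hsn (hst.dvd_of_dvd_mul_right h)
  have htm' : ¬ t ∣ m * s := fun h => htm (hst.symm.dvd_of_dvd_mul_right h)
  have c1 : ¬ (k ≡ n * t - m * s [ZMOD 2 * s * t] ∧ k ≡ -(n * t - m * s) [ZMOD 2 * s * t]) := by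
    rintro ⟨h1, h2⟩
    obtain ⟨q, hq⟩ := (h2.symm.trans h1).dvd
    apply hsn'
    exact ⟨m + t * q, by linarith⟩
  have c2 : ¬ (k ≡ n * t + m * s [ZMOD 2 * s * t] ∧ k ≡ -(n * t + m * s) [ZMOD 2 * s * t]) := by
    rintro ⟨h1, h2⟩
    obtain ⟨q, hq⟩ := (h2.symm.trans h1).dvd
    apply hsn'
    exact ⟨-m + t * q, by linarith⟩
  have c3 : ¬ (k ≡ n * t - m * s [ZMOD 2 * s * t] ∧ k ≡ n * t + m * s [ZMOD 2 * s * t]) := by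
    rintro ⟨h1, h2⟩
    obtain ⟨q, hq⟩ := (h1.symm.trans h2).dvd
    apply htm'
    exact ⟨s * q, by linarith⟩
  have c4 : ¬ (k ≡ n * t - m * s [ZMOD 2 * s * t] ∧ k ≡ -(n * t + m * s) [ZMOD 2 * s * t]) := by
    rintro ⟨h1, h2⟩
    obtain ⟨q, hq⟩ := (h2.symm.trans h1).dvd
    apply hsn'
    exact ⟨t * q, by linarith⟩
  have c5 : ¬ (k ≡ -(n * t - m * s) [ZMOD 2 * s * t] ∧ k ≡ n * t + m * s [ZMOD 2 * s * t]) := by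
    rintro ⟨h1, h2⟩
    obtain ⟨q, hq⟩ := (h1.symm.trans h2).dvd
    apply hsn'
    exact ⟨t * q, by linarith⟩
  have c6 : ¬ (k ≡ -(n * t - m * s) [ZMOD 2 * s * t] ∧ k ≡ -(n * t + m * s) [ZMOD 2 * s * t]) := by
    rintro ⟨h1, h2⟩
    obtain ⟨q, hq⟩ := (h2.symm.trans h1).dvd
    apply htm'
    exact ⟨s * q, by linarith⟩
  unfold chi
  by_cases h1 : k ≡ n * t - m * s [ZMOD 2 * s * t] <;>
  by_cases h2 : k ≡ -(n * t - m * s) [ZMOD 2 * s * t] <;>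
  by_cases h3 : k ≡ n * t + m * s [ZMOD 2 * s * t] <;>
  by_cases h4 : k ≡ -(n * t + m * s) [ZMOD 2 * s * t] <;>
  first
  | exact absurd (And.intro h1 h2) c1
  | exact absurd (And.intro h3 h4) c2
  | exact absurd (And.intro h1 h3) c3
  | exact absurd (And.intro h1 h4) c4
  | exact absurd (And.intro h2 h3) c5
  | exact absurd (And.intro h2 h4) c6
  | (simp only [h1, h2, h3, h4, if_true, if_false, or_true, or_false, true_or, false_or]; norm_num)

lemma chi_per (k q : ℤ) : chi s t n m (k + 2 * s * t * q) = chi s t n m k := by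
  have : ∀ a : ℤ, (k + 2 * s * t * q ≡ a [ZMOD 2 * s * t]) = (k ≡ a [ZMOD 2 * s * t]) := by
    intro a
    simp [Int.ModEq]
  unfold chi
  simp only [this]

lemma chi_zero (hs : 0 < s) (hst : IsCoprime s t)
    (hn : 0 < n) (hns : n < s) : chi s t n m 0 = 0 := by
  have hsn : ¬ s ∣ n := fun h => absurd (Int.le_of_dvd hn h) (by omega)
  have hsn' : ¬ s ∣ n * t := fun h => hsn (hst.dvd_of_dvd_mul_right h)
  unfold chi
  rw [if_neg, if_neg]
  · rintro (h | h) <;> obtain ⟨q, hq⟩ := h.dvd <;> apply hsn'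
    · exact ⟨-m + 2 * t * q, by linarith⟩
    · exact ⟨-m - 2 * t * q, by linarith⟩
  · rintro (h | h) <;> obtain ⟨q, hq⟩ := h.dvd <;> apply hsn'
    · exact ⟨m + 2 * t * q, by linarith⟩
    · exact ⟨m - 2 * t * q, by linarith⟩

lemma ind_sum (M : ℕ) (hM : 0 < M) (f : ℤ → ℂ) (hf : ∀ k q : ℤ, f (k + M * q) = f k) (a : ℤ) :
    ∑ l ∈ range M, (if (l : ℤ) ≡ a [ZMOD M] then (1 : ℂ) else 0) * f l = f a := by
  have hM' : (0 : ℤ) < M := by exact_mod_cast hM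
  obtain ⟨l0, hl0⟩ := Int.eq_ofNat_of_zero_le (Int.emod_nonneg a hM'.ne')
  have hlt : l0 < M := by
    have := Int.emod_lt_of_pos a hM'; omega
  rw [Finset.sum_eq_single l0]
  · have h1 : (l0 : ℤ) ≡ a [ZMOD M] := by rw [← hl0]; exact Int.mod_modEq a M
    rw [if_pos h1, one_mul, ← hl0]
    rw [← hf (a % M) (a / M), Int.emod_add_mul_ediv]
  · intro l hl hne
    rw [if_neg, zero_mul]
    intro h
    apply hne
    have h2 : (l : ℤ) % M = a % M := h
    rw [hl0, Int.emod_eq_of_lt (by positivity) (by exact_mod_cast Finset.mem_range.1 hl)] at h2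
    exact_mod_cast h2
  · intro h; exact absurd (Finset.mem_range.2 hlt) h

noncomputable def rho (s t n m : ℤ) (j : ℤ) : ℝ :=
  2 / ((s : ℝ) * t) * Real.sin (Real.pi * j * n / s) * Real.sin (Real.pi * j * m / t)

lemma rF_rho (hs : 0 < s) (ht : 0 < t) (hst : IsCoprime s t)
    (hn : 0 < n) (hns : n < s) (hm : 0 < m) (hmt : m < t) (M : ℕ) (hM : (M : ℤ) = 2 * s * t) (j : ℕ) :
    rF M (fun k => (chi s t n m k : ℂ)) j = (rho s t n m j : ℂ) := by
  have hM' : (0 : ℤ) < M := by rw [hM]; positivity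
  have hMn : 0 < M := by exact_mod_cast hM'
  have hMc : (M : ℂ) ≠ 0 := by exact_mod_cast hMn.ne'
  have hMc2 : (M : ℂ) = 2 * s * t := by exact_mod_cast congrArg (Int.cast : ℤ → ℂ) hM
  have hsr : (s : ℝ) ≠ 0 := by exact_mod_cast hs.ne'
  have htr : (t : ℝ) ≠ 0 := by exact_mod_cast ht.ne'
  have hsc : (s : ℂ) ≠ 0 := by exact_mod_cast hs.ne'
  have htc : (t : ℂ) ≠ 0 := by exact_mod_cast ht.ne'
  set f : ℤ → ℂ := fun l => cexp (-(2 * Real.pi * I * l * (j / M))) with hfd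
  have hf : ∀ k q : ℤ, f (k + M * q) = f k := by
    intro k q
    simp only [hfd]
    rw [show -(2 * (Real.pi : ℂ) * I * ((k + M * q : ℤ) : ℂ) * (j / M)) =
      -(2 * Real.pi * I * k * (j / M)) + ((-(q * j) : ℤ) : ℂ) * (2 * Real.pi * I) by
        push_cast; field_simp; ring]
    rw [Complex.exp_add, exp_int_mul_two_pi_mul_I, mul_one]
  have hsum : ∑ l ∈ range M, (chi s t n m l : ℂ) * f l =
      f (n * t - m * s) + f (-(n * t - m * s)) - f (n * t + m * s) - f (-(n * t + m * s)) := by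
    simp_rw [ind_eq hs ht hst hn hns hm hmt, sub_mul, add_mul, ← hM]
    rw [Finset.sum_sub_distrib, Finset.sum_sub_distrib, Finset.sum_add_distrib]
    rw [ind_sum M hMn f hf, ind_sum M hMn f hf, ind_sum M hMn f hf, ind_sum M hMn f hf]
  have hcos : ∀ a : ℤ, f a + f (-a) = ((2 * Real.cos (Real.pi * j * a / (s * t)) : ℝ) : ℂ) := by
    intro a
    simp only [hfd]
    push_cast
    rw [Complex.two_cos]
    rw [add_comm]
    congr 2
    · rw [hMc2]; field_simp
    · rw [hMc2]; field_simp
  unfold rF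
  have hsum' : ∑ l ∈ range M, (chi s t n m l : ℂ) * cexp (-(2 * Real.pi * I * l * (j / M))) =
      (f (n * t - m * s) + f (-(n * t - m * s))) - (f (n * t + m * s) + f (-(n * t + m * s))) := by
    rw [← sub_sub, ← hsum]
    simp [hfd]
  rw [hsum', hcos, hcos, ← ofReal_sub, ← mul_sub, Real.cos_sub_cos]
  unfold rho
  have a1 : (Real.pi * j * ((n * t - m * s : ℤ) : ℝ) / (s * t) + Real.pi * j * ((n * t + m * s : ℤ) : ℝ) / (s * t)) / 2 =
      Real.pi * j * n / s := by push_cast; field_simp; ring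
  have a2 : (Real.pi * j * ((n * t - m * s : ℤ) : ℝ) / (s * t) - Real.pi * j * ((n * t + m * s : ℤ) : ℝ) / (s * t)) / 2 =
      -(Real.pi * j * m / t) := by push_cast; field_simp; ring
  rw [a1, a2, Real.sin_neg, hMc2]
  push_cast
  field_simp

lemma rho_zero (hs : 0 < s) (ht : 0 < t) (j : ℤ) (h : s ∣ j ∨ t ∣ j) : rho s t n m j = 0 := by
  have hsr : (s : ℝ) ≠ 0 := by exact_mod_cast hs.ne'
  have htr : (t : ℝ) ≠ 0 := by exact_mod_cast ht.ne'
  unfold rho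
  rcases h with ⟨q, rfl⟩ | ⟨q, rfl⟩
  · have : Real.sin (Real.pi * ((s * q : ℤ) : ℝ) * n / s) = 0 := by
      rw [show Real.pi * ((s * q : ℤ) : ℝ) * n / s = ((q * n : ℤ) : ℝ) * Real.pi by push_cast; field_simp]
      exact Real.sin_int_mul_pi _
    rw [this]; ring
  · have : Real.sin (Real.pi * ((t * q : ℤ) : ℝ) * m / t) = 0 := by
      rw [show Real.pi * ((t * q : ℤ) : ℝ) * m / t = ((q * m : ℤ) : ℝ) * Real.pi by push_cast; field_simp]
      exact Real.sin_int_mul_pi _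
    rw [this]; ring

lemma rho_refl (hs : 0 < s) (ht : 0 < t) (j : ℤ) : rho s t n m (2 * s * t - j) = rho s t n m j := by
  have hsr : (s : ℝ) ≠ 0 := by exact_mod_cast hs.ne'
  have htr : (t : ℝ) ≠ 0 := by exact_mod_cast ht.ne'
  unfold rho
  have e1 : Real.sin (Real.pi * ((2 * s * t - j : ℤ) : ℝ) * n / s) = - Real.sin (Real.pi * j * n / s) := by
    rw [show Real.pi * ((2 * s * t - j : ℤ) : ℝ) * n / s = -(Real.pi * j * n / s) + ((t * n : ℤ) : ℝ) * (2 * Real.pi) by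
      push_cast; field_simp; ring]
    rw [Real.sin_add_int_mul_two_pi, Real.sin_neg]
  have e2 : Real.sin (Real.pi * ((2 * s * t - j : ℤ) : ℝ) * m / t) = - Real.sin (Real.pi * j * m / t) := by
    rw [show Real.pi * ((2 * s * t - j : ℤ) : ℝ) * m / t = -(Real.pi * j * m / t) + ((s * m : ℤ) : ℝ) * (2 * Real.pi) by
      push_cast; field_simp; ring]
    rw [Real.sin_add_int_mul_two_pi, Real.sin_neg]
  rw [e1, e2]; ring

lemma rho_pm (hs : 0 < s) (ht : 0 < t) (a b : ℤ) (σ : ℤ) (hσ : σ = 1 ∨ σ = -1) :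
    rho s t n m (a * t + σ * (b * s)) = σ * (2 / ((s : ℝ) * t) * (-1) ^ (n * b + a * m) *
      Real.sin ((n : ℝ) * a * t * Real.pi / s) * Real.sin ((m : ℝ) * b * s * Real.pi / t)) := by
  have hsr : (s : ℝ) ≠ 0 := by exact_mod_cast hs.ne'
  have htr : (t : ℝ) ≠ 0 := by exact_mod_cast ht.ne'
  unfold rho
  have e1 : Real.sin (Real.pi * ((a * t + σ * (b * s) : ℤ) : ℝ) * n / s) =
      (-1) ^ (n * b) * Real.sin ((n : ℝ) * a * t * Real.pi / s) := by
    have h1 : ((-1 : ℝ)) ^ (n * b) = (-1) ^ (σ * (n * b)) := by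
      rcases hσ with rfl | rfl
      · rw [one_mul]
      · rw [neg_one_mul, zpow_neg, ← inv_zpow]; norm_num
    rw [h1, ← Real.sin_add_int_mul_pi]
    congr 1
    push_cast; field_simp
  have e2 : Real.sin (Real.pi * ((a * t + σ * (b * s) : ℤ) : ℝ) * m / t) =
      (-1) ^ (a * m) * (σ * Real.sin ((m : ℝ) * b * s * Real.pi / t)) := by
    have h1 : (σ * Real.sin ((m : ℝ) * b * s * Real.pi / t)) = Real.sin (σ * ((m : ℝ) * b * s * Real.pi / t)) := by
      rcases hσ with rfl | rfl
      · simp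
      · push_cast; rw [neg_one_mul, neg_one_mul, Real.sin_neg]
    rw [h1, ← Real.sin_add_int_mul_pi]
    congr 1
    push_cast; field_simp; ring
  rw [e1, e2, zpow_add₀ (by norm_num)]
  ring
end arith


lemma exp_sq_eq (M : ℕ) (hM : 0 < M) (N : ℕ) (u v z : ℤ) (h : u ^ 2 = v ^ 2 + 2 * M * z) :
    cexp (-(Real.pi * I * ((M : ℂ) * N) * ((u : ℂ) / M) ^ 2)) =
      cexp (-(Real.pi * I * (v : ℂ) ^ 2 * N / M)) := by
  have hM' : (M : ℂ) ≠ 0 := by exact_mod_cast hM.ne'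
  have h' : (u : ℂ) ^ 2 = (v : ℂ) ^ 2 + 2 * M * z := by exact_mod_cast h
  rw [Complex.exp_eq_exp_iff_exists_int]
  refine ⟨-(z * N), ?_⟩
  rw [div_pow, h']
  push_cast
  field_simp
  ring

lemma four_sum (s t n m : ℤ) (hs : 0 < s) (ht : 0 < t) (M : ℕ) (hM : (M : ℤ) = 2 * s * t)
    (N : ℕ) (κ : ℂ) (g : ℤ → ℂ)
    (hg : ∀ j : ℤ, g j = (rho s t n m j : ℂ) * (((j : ℂ) / M) ^ 2 - (j : ℂ) / M + κ) *
      cexp (-(Real.pi * I * ((M : ℂ) * N) * ((j : ℂ) / M) ^ 2))) (a b : ℤ) :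
    g (a * t - b * s) + g (2 * s * t - (a * t - b * s)) + g (a * t + b * s)
      + g (2 * s * t - (a * t + b * s)) =
    (4 / ((s : ℂ) * t) ^ 2) * (((-1 : ℝ) ^ (n * b + a * m + 1) *
      Real.sin ((n : ℝ) * a * t * Real.pi / s) * Real.sin ((m : ℝ) * b * s * Real.pi / t) : ℝ) : ℂ)
      * (((s - a) * b : ℤ) : ℂ) *
      cexp (-(Real.pi * I * ((a * t - b * s : ℤ) : ℂ) ^ 2 * (N : ℂ) / (2 * s * t))) := by
  have hM0 : 0 < M := by
    have : (0 : ℤ) < M := by rw [hM]; positivity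
    exact_mod_cast this
  have hMC : (M : ℂ) = 2 * s * t := by exact_mod_cast congrArg (Int.cast : ℤ → ℂ) hM
  have hsC : (s : ℂ) ≠ 0 := by exact_mod_cast hs.ne'
  have htC : (t : ℂ) ≠ 0 := by exact_mod_cast ht.ne'
  have r1 := rho_pm (n := n) (m := m) hs ht a b (-1) (Or.inr rfl)
  have r2 := rho_pm (n := n) (m := m) hs ht a b 1 (Or.inl rfl)
  rw [show a * t + -1 * (b * s) = a * t - b * s by ring] at r1
  rw [show a * t + 1 * (b * s) = a * t + b * s by ring] at r2
  have e1 := exp_sq_eq M hM0 N (a * t - b * s) (a * t - b * s) 0 (by ring)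
  have e2 := exp_sq_eq M hM0 N (2 * s * t - (a * t - b * s)) (a * t - b * s)
    (s * t - (a * t - b * s)) (by rw [hM]; ring)
  have e3 := exp_sq_eq M hM0 N (a * t + b * s) (a * t - b * s) (a * b) (by rw [hM]; ring)
  have e4 := exp_sq_eq M hM0 N (2 * s * t - (a * t + b * s)) (a * t - b * s)
    (s * t - (a * t + b * s) + a * b) (by rw [hM]; ring)
  rw [hg, hg, hg, hg, e1, e2, e3, e4, rho_refl hs ht, rho_refl hs ht, r1, r2, hMC,
    zpow_add_one₀ (by norm_num)]
  generalize cexp _ = E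
  generalize (-1 : ℝ) ^ (n * b + a * m) = X
  generalize Real.sin _ = Y
  generalize Real.sin _ = Z
  push_cast
  field_simp
  ring

lemma powhalf (N : ℕ) (hN : 0 < N) :
    ((N : ℂ) / Complex.I) ^ ((3 : ℂ) / 2) = -((N : ℂ) * (Real.sqrt N : ℂ) * ep') := by
  have hN' : (0 : ℝ) < N := by exact_mod_cast hN
  have h1 : (N : ℂ) / I = ((N : ℝ) : ℂ) * (-I) := by rw [div_I]; push_cast; ring
  have hne : ((N : ℝ) : ℂ) * (-I) ≠ 0 :=
    mul_ne_zero (by exact_mod_cast hN'.ne') (neg_ne_zero.mpr I_ne_zero)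
  have hsq : Real.sqrt N = Real.exp (Real.log N / 2) := by
    rw [Real.exp_half, Real.exp_log hN']
  have hNe : (N : ℂ) = cexp (Real.log N : ℂ) := by
    rw [← ofReal_exp, Real.exp_log hN']; simp
  have h4 : ep' = cexp ((Real.pi / 4 : ℝ) * I) := by
    rw [Complex.exp_mul_I, ← ofReal_cos, ← ofReal_sin, Real.cos_pi_div_four, Real.sin_pi_div_four]
    have : hR = Real.sqrt 2 / 2 := by
      unfold hR
      rw [inv_eq_one_div, div_eq_div_iff (by positivity) (by norm_num)]
      rw [Real.mul_self_sqrt (by norm_num)]; norm_num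
    unfold ep'
    rw [this]
    ring
  rw [h1, cpow_def_of_ne_zero hne, log_ofReal_mul hN' (neg_ne_zero.mpr I_ne_zero), log_neg_I,
    hNe, hsq, h4, ofReal_exp, ← Complex.exp_add, ← Complex.exp_add]
  rw [← neg_one_mul (cexp _), ← Complex.exp_neg_pi_mul_I, ← Complex.exp_add]
  congr 1
  push_cast
  ring

lemma prefac (s t : ℤ) (hs : 0 < s) (ht : 0 < t) (M : ℕ) (hM : (M : ℤ) = 2 * s * t)
    (N : ℕ) (W : ℕ) (hW : W = M * N) :
    (W : ℝ) / 4 * Real.sqrt W * (4 / ((s : ℝ) * t) ^ 2) =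
      N * Real.sqrt N * Real.sqrt (8 / ((s : ℝ) * t)) := by
  have hMR : (M : ℝ) = 2 * s * t := by exact_mod_cast congrArg (Int.cast : ℤ → ℝ) hM
  have hsR : (0 : ℝ) < s := by exact_mod_cast hs
  have htR : (0 : ℝ) < t := by exact_mod_cast ht
  have hx : (0 : ℝ) < s * t := by positivity
  have hWR : (W : ℝ) = N * (2 * (s * t)) := by rw [hW]; push_cast; rw [hMR]; ring
  have h8 : Real.sqrt (8 / ((s : ℝ) * t)) = 2 / (s * t) * Real.sqrt (2 * (s * t)) := by
    rw [Real.sqrt_eq_iff_mul_self_eq (by positivity) (by positivity)]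
    rw [show (2 / ((s : ℝ) * t) * Real.sqrt (2 * (s * t))) * (2 / (s * t) * Real.sqrt (2 * (s * t))) =
      (2 / (s * t)) ^ 2 * (Real.sqrt (2 * (s * t))) ^ 2 by ring, Real.sq_sqrt (by positivity)]
    field_simp
    norm_num
  rw [hWR, Real.sqrt_mul (by positivity), h8]
  field_simp

lemma sum_Icc_range (X : ℕ) (F : ℤ → ℂ) (h0 : F 0 = 0) (hX : F X = 0) :
    ∑ k ∈ Finset.Icc (1 : ℤ) X, F k = ∑ k ∈ range X, F (k : ℤ) := by
  have h1 : ∑ k ∈ Finset.Icc (1 : ℤ) X, F k = ∑ k ∈ range X, F ((k : ℤ) + 1) := by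
    symm
    refine Finset.sum_bij (fun k _ => (k : ℤ) + 1) ?_ ?_ ?_ ?_
    · intro k hk; rw [Finset.mem_range] at hk; rw [Finset.mem_Icc]; omega
    · intro a _ b _ h; simpa using h
    · intro b hb
      rw [Finset.mem_Icc] at hb
      exact ⟨(b - 1).toNat, by rw [Finset.mem_range]; omega, by omega⟩
    · intro k _; rfl
  rw [h1]
  have h2 := Finset.sum_range_succ (fun k : ℕ => F (k : ℤ)) X
  have h3 := Finset.sum_range_succ' (fun k : ℕ => F (k : ℤ)) X
  rw [h2] at h3
  simp only [Nat.cast_zero, h0, hX, add_zero, Nat.cast_add, Nat.cast_one] at h3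
  exact h3.symm

lemma sum_Ico_Ioo (X : ℕ) (F : ℤ → ℂ) :
    ∑ k ∈ Ico 1 X, F (k : ℤ) = ∑ k ∈ Finset.Ioo (0 : ℤ) X, F k := by
  refine Finset.sum_bij (fun k _ => (k : ℤ)) ?_ ?_ ?_ ?_
  · intro k hk; rw [Finset.mem_Ico] at hk; rw [Finset.mem_Ioo]; omega
  · intro a _ b _ h; simpa using h
  · intro b hb
    rw [Finset.mem_Ioo] at hb
    exact ⟨b.toNat, by rw [Finset.mem_Ico]; omega, by omega⟩
  · intro k _; rfl

lemma main_est (s t n m : ℤ) (hs : 0 < s) (ht : 0 < t) (hst : IsCoprime s t)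
    (hn : 0 < n) (hns : n < s) (hm : 0 < m) (hmt : m < t) (K : ℕ) :
    ∃ C : ℝ, ∀ N : ℕ, 0 < N →
      ‖PhiTilde s t n m N
          + ((N : ℂ) / Complex.I) ^ ((3 : ℂ) / 2) *
            ∑ x ∈ Pset s t,
              (Scoef s t n m x.1 x.2 : ℂ) * (((s - x.1) * x.2 : ℤ) : ℂ) *
                Complex.exp (-(Real.pi * Complex.I * ((x.1 * t - x.2 * s : ℤ) : ℂ) ^ 2 * (N : ℂ)
                  / (2 * s * t)))
          + (1 / 2 : ℂ) * ∑ k ∈ Finset.range (K + 1),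
              Lval s t n m (2 * k + 1) / (Nat.factorial k : ℂ) *
                (Real.pi * Complex.I / (2 * s * t * N)) ^ k‖
        ≤ C / (N : ℝ) ^ (K + 1) := by
  obtain ⟨M, hM⟩ : ∃ M : ℕ, (M : ℤ) = 2 * s * t := ⟨(2 * s * t).toNat, Int.toNat_of_nonneg (by positivity)⟩
  have hM0 : 0 < M := by
    have : (0 : ℤ) < M := by rw [hM]; positivity
    exact_mod_cast this
  have hev : Even M := by
    have : Even (M : ℤ) := by rw [hM]; exact ⟨s * t, by ring⟩
    exact_mod_cast this
  have hMC : (M : ℂ) = 2 * s * t := by exact_mod_cast congrArg (Int.cast : ℤ → ℂ) hM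
  have hMC0 : (M : ℂ) ≠ 0 := by exact_mod_cast hM0.ne'
  have hMQ : (M : ℚ) = 2 * s * t := by exact_mod_cast congrArg (Int.cast : ℤ → ℚ) hM
  set c : ℕ → ℂ := fun k => (chi s t n m (k : ℤ) : ℂ) with hc_def
  have hc : Function.Periodic c M := by
    intro k
    simp only [hc_def]
    have := chi_per (s := s) (t := t) (n := n) (m := m) k 1
    rw [mul_one, ← hM] at this
    push_cast
    rw [this]
  have hrF := fun j : ℕ => rF_rho hs ht hst hn hns hm hmt M hM j
  have hsum : ∑ l ∈ range M, c l = 0 := by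
    have h0 := hrF 0
    unfold rF rho at h0
    simp only [Nat.cast_zero, zero_div, mul_zero, neg_zero, Complex.exp_zero, mul_one, Int.cast_zero,
      zero_mul, Real.sin_zero, ofReal_zero] at h0
    rcases mul_eq_zero.mp h0 with h | h
    · exact absurd h (by simpa using hM0.ne')
    · exact h
  have hz : chi s t n m 0 = 0 := chi_zero hs hst hn hns
  have hzM : ∀ N : ℕ, chi s t n m ((M * N : ℕ) : ℤ) = 0 := by
    intro N
    have := chi_per (s := s) (t := t) (n := n) (m := m) 0 N
    rw [hz, zero_add, ← hM] at this
    push_cast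
    exact this
  obtain ⟨C, hC⟩ := asym M hM0 c hc hsum K
  refine ⟨C, fun N hN => ?_⟩
  obtain ⟨W, hW⟩ : ∃ W : ℕ, W = M * N := ⟨_, rfl⟩
  have hWC : (W : ℂ) = M * N := by rw [hW]; push_cast; ring
  have hC' := hC N hN W hW
  -- Phi
  have hPhi : PhiTilde s t n m N = (W : ℂ) / 4 * ∑ k ∈ range W,
      c k * cexp (Real.pi * I * k ^ 2 / W) * (((k : ℂ) / W) ^ 2 - k / W + 1 / 6) := by
    unfold PhiTilde
    have hX : 2 * s * t * (N : ℤ) = (W : ℤ) := by rw [hW]; push_cast; rw [hM]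
    have hXC : 2 * (s : ℂ) * t * N = W := by rw [hWC, hMC]
    rw [hX, hXC, sum_Icc_range W]
    · congr 1
      rw [← hXC]; push_cast; ring
    · rw [hz]; simp
    · rw [show ((W : ℕ) : ℤ) = ((M * N : ℕ) : ℤ) by rw [hW], hzM N]; simp
  have hsplit := phi_split M hM0 hev c hc hsum N hN W hW
  -- L values
  have hL : (1 / 2 : ℂ) * ∑ k ∈ Finset.range (K + 1),
              Lval s t n m (2 * k + 1) / (Nat.factorial k : ℂ) *
                (Real.pi * Complex.I / (2 * s * t * N)) ^ k =
      -∑ k ∈ range (K + 1), (1 / 4 : ℂ) * M ^ (2 * k + 1) * bet M c (2 * k + 2) /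
        (k + 1).factorial * (Real.pi * I / W) ^ k := by
    rw [Finset.mul_sum, ← Finset.sum_neg_distrib]
    refine Finset.sum_congr rfl fun k _ => ?_
    have hb : ∑ l ∈ Finset.Icc (1 : ℤ) (2 * s * t), (chi s t n m l : ℂ) *
        (((Polynomial.bernoulli (2 * k + 1 + 1)).eval ((l : ℚ) / (2 * s * t)) : ℚ) : ℂ) =
        bet M c (2 * k + 2) := by
      rw [← hM, ← hMQ, sum_Icc_range M]
      · unfold bet
        simp only [hc_def, Int.cast_natCast]
      · rw [hz]; simp
      · have := hzM 1
        rw [mul_one] at this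
        rw [this]; simp
    unfold Lval
    rw [hb, ← hM, ← hMC, ← hWC, Nat.factorial_succ]
    have hf : (k.factorial : ℂ) ≠ 0 := by exact_mod_cast k.factorial_ne_zero
    have hk : (k : ℂ) + 1 ≠ 0 := by exact_mod_cast k.succ_ne_zero
    have hk2 : (2 * (k : ℂ) + 1 + 1) = 2 * (k + 1) := by ring
    push_cast
    rw [hk2]
    field_simp
    ring
  -- residue sum
  have hres : (W : ℂ) / 4 * (Real.sqrt W : ℂ) * (ep' * ∑ j ∈ Ico 1 M, rF M c j *
      (((j : ℂ) / M) ^ 2 - j / M + (1 / 6 - kap W)) * cexp (-(Real.pi * I * W * ((j : ℂ) / M) ^ 2))) =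
      -(((N : ℂ) / Complex.I) ^ ((3 : ℂ) / 2) *
            ∑ x ∈ Pset s t,
              (Scoef s t n m x.1 x.2 : ℂ) * (((s - x.1) * x.2 : ℤ) : ℂ) *
                Complex.exp (-(Real.pi * Complex.I * ((x.1 * t - x.2 * s : ℤ) : ℂ) ^ 2 * (N : ℂ)
                  / (2 * s * t)))) := by
    set g : ℤ → ℂ := fun j => (rho s t n m j : ℂ) * (((j : ℂ) / M) ^ 2 - (j : ℂ) / M +
      (1 / 6 - kap W)) * cexp (-(Real.pi * I * ((M : ℂ) * N) * ((j : ℂ) / M) ^ 2)) with hg_def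
    have hgs : ∑ j ∈ Ico 1 M, rF M c j *
      (((j : ℂ) / M) ^ 2 - j / M + (1 / 6 - kap W)) * cexp (-(Real.pi * I * W * ((j : ℂ) / M) ^ 2)) =
      ∑ j ∈ Ico 1 M, g (j : ℤ) := by
      refine Finset.sum_congr rfl fun j _ => ?_
      rw [hrF j, hWC]
      simp only [hg_def, Int.cast_natCast]
    have hpre := congrArg (Complex.ofReal) (prefac s t hs ht M hM N W hW)
    push_cast at hpre
    rw [hgs, sum_Ico_Ioo, hM, regroup s t hs ht hst g (by
      intro j hj
      simp only [hg_def]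
      rw [rho_zero hs ht j hj]; simp), powhalf N hN, neg_mul, neg_neg, Finset.mul_sum, Finset.mul_sum,
      Finset.mul_sum]
    refine Finset.sum_congr rfl fun x _ => ?_
    rw [four_sum s t n m hs ht M hM N _ g (fun j => rfl)]
    unfold Scoef
    generalize cexp _ = E
    generalize (-1 : ℝ) ^ (n * x.2 + x.1 * m + 1) = X
    generalize Real.sin _ = Y
    generalize Real.sin _ = Z
    push_cast at hpre ⊢
    linear_combination (ep' * X * Y * Z * (s - x.1) * x.2 * E) * hpre
  rw [hL, hPhi, hsplit]
  refine le_trans (le_of_eq ?_) hC'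
  congr 1
  linear_combination hres

theorem statement16 (s t n m : ℤ) (hs : 0 < s) (ht : 0 < t) (hst : IsCoprime s t)
    (hn : 0 < n) (hns : n < s) (hm : 0 < m) (hmt : m < t) (K : ℕ) :
    ∃ C : ℝ, ∀ N : ℕ, 0 < N →
      ‖PhiTilde s t n m N
          + ((N : ℂ) / Complex.I) ^ ((3 : ℂ) / 2) *
            ∑ x ∈ (Finset.Icc (1 : ℤ) (s - 1) ×ˢ Finset.Icc (1 : ℤ) (t - 1)).filter
                (fun x => 0 < x.1 * t - x.2 * s),
              (Scoef s t n m x.1 x.2 : ℂ) * (((s - x.1) * x.2 : ℤ) : ℂ) *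
                Complex.exp (-(Real.pi * Complex.I * ((x.1 * t - x.2 * s : ℤ) : ℂ) ^ 2 * (N : ℂ)
                  / (2 * s * t)))
          + (1 / 2 : ℂ) * ∑ k ∈ Finset.range (K + 1),
              Lval s t n m (2 * k + 1) / (Nat.factorial k : ℂ) *
                (Real.pi * Complex.I / (2 * s * t * N)) ^ k‖
        ≤ C / (N : ℝ) ^ (K + 1) := by
  exact main_est s t n m hs ht hst hn hns hm hmt K
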